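/- arXiv:2509.00592 — 5 statements merged into one kernel-verified Lean document; each statement's English description precedes it below -/
import Mathlib

section
/- Claim (quadrics are controlled by Pfister forms over a purely transcendental extension). Let F be a field of characteristic ≠ 2 and let q be a nondegenerate quadratic form on F^r with r ≥ 2. Then there exist natural numbers m, n and units a_1, …, a_n of F(x_1, …, x_m) such that for every field extension L/F: q is isotropic over L if and only if the n-fold Pfister form ⟨⟨a_1, …, a_n⟩⟩ is isotropic over L(x_1, …, x_m) (the a_i transported along the canonical embedding F(x_1, …, x_m) → L(x_1, …, x_m)). -/
noncomputable section

open scoped BigOperators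

/-- A quadratic form is *isotropic* if it vanishes on some nonzero vector. -/
def QuadraticMap.IsIsotropic {R M : Type*} [CommSemiring R] [AddCommMonoid M] [Module R M]
    (q : QuadraticForm R M) : Prop :=
  ∃ v, v ≠ 0 ∧ q v = 0

/-- `p` is a subform of `q` -/
def QuadraticMap.IsSubform {R M₁ M₂ : Type*} [CommSemiring R] [AddCommMonoid M₁]
    [AddCommMonoid M₂] [Module R M₁] [Module R M₂]
    (p : QuadraticForm R M₁) (q : QuadraticForm R M₂) : Prop :=
  ∃ f : M₁ →ₗ[R] M₂, Function.Injective f ∧ ∀ v, q (f v) = p v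

/-- Base change of a quadratic form on `k^n` along a ring homomorphism `f : k →+* E`:
the quadratic form on `E^n` whose values on the standard basis vectors, and whose polar
values on pairs of standard basis vectors, are the images under `f` of those of `q`. -/
def QuadraticForm.mapAlong {k E : Type*} [CommRing k] [CommRing E] (f : k →+* E) {n : ℕ}
    (q : QuadraticForm k (Fin n → k)) : QuadraticForm E (Fin n → E) :=
  Matrix.toQuadraticMap' (Matrix.of fun i j =>
    if i = j then f (q (Pi.single i 1))
    else if i < j then f (QuadraticMap.polar ⇑q (Pi.single i 1) (Pi.single j 1)) else 0)

/-- The `n`-fold Pfister form `⟨⟨a_1, …, a_n⟩⟩`: the diagonal quadratic form of rank `2^n`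
whose diagonal entries, indexed by the subsets `S ⊆ {1, …, n}`, are `∏_{i ∈ S} (-a_i)`. -/
def PfisterForm {F : Type*} [Field F] {n : ℕ} (a : Fin n → F) :
    QuadraticForm F (Finset (Fin n) → F) :=
  QuadraticMap.weightedSumSquares F (fun S : Finset (Fin n) => ∏ i ∈ S, (-a i))

/-- The canonical ring embedding of `F` into `F(x_1, …, x_m)`. -/
def toFrac (F : Type*) [Field F] (m : ℕ) : F →+* FractionRing (MvPolynomial (Fin m) F) :=
  (algebraMap (MvPolynomial (Fin m) F) (FractionRing (MvPolynomial (Fin m) F))).comp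
    MvPolynomial.C

/-- The canonical embedding `F(x_1, …, x_m) → L(x_1, …, x_m)` induced by `F → L`. -/
def transMap (F L : Type*) [Field F] [Field L] [Algebra F L] (m : ℕ) :
    FractionRing (MvPolynomial (Fin m) F) →+* FractionRing (MvPolynomial (Fin m) L) :=
  IsFractionRing.lift (g := (algebraMap (MvPolynomial (Fin m) L)
      (FractionRing (MvPolynomial (Fin m) L))).comp (MvPolynomial.map (algebraMap F L)))
    (((IsFractionRing.injective (MvPolynomial (Fin m) L)
        (FractionRing (MvPolynomial (Fin m) L))).comp
      (MvPolynomial.map_injective _ (algebraMap F L).injective)))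

/-- The generic value `p(X)` of a quadratic form `p` on `k^n`: the value of the base change
of `p` to `k(X_1, …, X_n)` at the vector of indeterminates. -/
def genericValue {k : Type*} [Field k] {n : ℕ} (p : QuadraticForm k (Fin n → k)) :
    FractionRing (MvPolynomial (Fin n) k) :=
  (p.mapAlong (toFrac k n)) fun i =>
    algebraMap (MvPolynomial (Fin n) k) (FractionRing (MvPolynomial (Fin n) k))
      (MvPolynomial.X i)

/-- `E` is a finite extension of odd degree of `F`, via the ring homomorphism `f`. -/
def IsOddFiniteExt (F E : Type*) [Field F] [Field E] (f : F →+* E) : Prop :=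
  letI : Algebra F E := f.toAlgebra
  FiniteDimensional F E ∧ Odd (Module.finrank F E)

universe u

section DiagonalForms

variable {K : Type*} [Field K]

/-- The diagonal quadratic form with the given list of coefficients takes the value `z`. -/
def DiagRep : List K → K → Prop
  | [], z => z = 0
  | d :: l, z => ∃ x, DiagRep l (z - d * x ^ 2)

/-- The diagonal quadratic form with the given list of coefficients is isotropic. -/
def DiagIso : List K → Prop
  | [] => False
  | d :: l => DiagIso l ∨ ∃ x, x ≠ 0 ∧ DiagRep l (-(d * x ^ 2))

theorem diagRep_ofFn {n : ℕ} (w : Fin n → K) (z : K) :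
    DiagRep (List.ofFn w) z ↔ ∃ v : Fin n → K, ∑ i, w i * v i ^ 2 = z := by
  induction n generalizing z with
  | zero => simp [DiagRep, eq_comm]
  | succ n ih =>
    simp only [List.ofFn_succ, DiagRep, ih, Fin.sum_univ_succ]
    constructor
    · rintro ⟨x, v, hv⟩
      exact ⟨Fin.cons x v, by simp [hv]⟩
    · rintro ⟨v, hv⟩
      exact ⟨v 0, fun i => v i.succ, by rw [← hv]; ring⟩

theorem diagIso_ofFn {n : ℕ} (w : Fin n → K) :
    DiagIso (List.ofFn w) ↔ ∃ v : Fin n → K, v ≠ 0 ∧ ∑ i, w i * v i ^ 2 = 0 := by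
  induction n with
  | zero => exact ⟨False.elim, fun ⟨v, hv, _⟩ => hv (Subsingleton.elim _ _)⟩
  | succ n ih =>
    simp only [List.ofFn_succ, DiagIso, ih, Fin.sum_univ_succ, diagRep_ofFn]
    constructor
    · rintro (⟨v, hv, h⟩ | ⟨x, hx, v, h⟩)
      · refine ⟨Fin.cons 0 v, fun h0 => hv (funext fun i => ?_), by simp [h]⟩
        simpa using congrFun h0 i.succ
      · exact ⟨Fin.cons x v, fun h0 => hx (by simpa using congrFun h0 0), by simp [h]⟩
    · rintro ⟨v, hv, h⟩
      by_cases h0 : v 0 = 0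
      · refine Or.inl ⟨fun i => v i.succ, fun h1 => hv (funext fun i => ?_), by simpa [h0] using h⟩
        refine Fin.cases h0 (fun j => congrFun h1 j) i
      · exact Or.inr ⟨v 0, h0, fun i => v i.succ, by linear_combination h⟩

theorem DiagRep.zero (l : List K) : DiagRep l 0 := by
  induction l with
  | nil => rfl
  | cons d l ih => exact ⟨0, by simpa using ih⟩

theorem diagIso_cons_cons (d e : K) (l : List K) :
    DiagIso (d :: e :: l) ↔
      DiagIso l ∨ ∃ x y, (x ≠ 0 ∨ y ≠ 0) ∧ DiagRep l (-(d * x ^ 2 + e * y ^ 2)) := by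
  simp only [DiagIso, DiagRep]
  constructor
  · rintro ((h | ⟨y, hy, h⟩) | ⟨x, hx, y, h⟩)
    · exact Or.inl h
    · exact Or.inr ⟨0, y, Or.inr hy, by simpa using h⟩
    · exact Or.inr ⟨x, y, Or.inl hx, by convert h using 1; ring⟩
  · rintro (h | ⟨x, y, hxy, h⟩)
    · exact Or.inl (Or.inl h)
    · by_cases hx : x = 0
      · subst hx
        exact Or.inl (Or.inr ⟨y, by simpa using hxy, by simpa using h⟩)
      · exact Or.inr ⟨x, hx, y, by convert h using 1; ring⟩

theorem diagRep_cons_cons (d e : K) (l : List K) (z : K) :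
    DiagRep (d :: e :: l) z ↔ ∃ x y, DiagRep l (z - (d * x ^ 2 + e * y ^ 2)) := by
  simp only [DiagRep, sub_sub]

/-- Two diagonal forms take the same values and are simultaneously isotropic. -/
def SameValues (l l' : List K) : Prop :=
  (DiagIso l ↔ DiagIso l') ∧ ∀ z, DiagRep l z ↔ DiagRep l' z

namespace SameValues

theorem refl (l : List K) : SameValues l l := ⟨Iff.rfl, fun _ => Iff.rfl⟩

theorem trans {l l' l'' : List K} (h : SameValues l l') (h' : SameValues l' l'') :
    SameValues l l'' :=
  ⟨h.1.trans h'.1, fun z => (h.2 z).trans (h'.2 z)⟩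

theorem cons (d : K) {l l' : List K} (h : SameValues l l') : SameValues (d :: l) (d :: l') := by
  simp only [SameValues, DiagIso, DiagRep, h.1, h.2, implies_true, and_self]

theorem append_left (p : List K) {l l' : List K} (h : SameValues l l') :
    SameValues (p ++ l) (p ++ l') := by
  induction p with
  | nil => exact h
  | cons d p ih => exact ih.cons d

theorem of_perm {l l' : List K} (h : l.Perm l') : SameValues l l' := by
  induction h with
  | nil => exact refl _
  | cons d _ ih => exact ih.cons d
  | swap d e l =>
    refine ⟨?_, fun z => ?_⟩
    · rw [diagIso_cons_cons, diagIso_cons_cons, exists_comm]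
      refine or_congr_right (exists_congr fun x => exists_congr fun y => ?_)
      rw [or_comm, add_comm]
    · rw [diagRep_cons_cons, diagRep_cons_cons, exists_comm]
      simp only [add_comm (e * _)]
  | trans _ _ ih ih' => exact ih.trans ih'

theorem append_right (p : List K) {l l' : List K} (h : SameValues l l') :
    SameValues (l ++ p) (l' ++ p) :=
  (of_perm List.perm_append_comm).trans ((h.append_left p).trans (of_perm List.perm_append_comm))

/-- If `⟨d, e⟩` represents `s ≠ 0`, then `⟨d, e⟩ ≅ ⟨s, d e s⟩`. -/
theorem binary {d e s x y : K} (hs : d * x ^ 2 + e * y ^ 2 = s) (hs0 : s ≠ 0) (l : List K) :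
    SameValues (d :: e :: l) (s :: d * e * s :: l) := by
  have key (X Y : K) : d * (x * X - e * y * Y) ^ 2 + e * (y * X + d * x * Y) ^ 2 =
      s * X ^ 2 + d * e * s * Y ^ 2 := by rw [← hs]; ring
  have inv (X Y : K) : ∃ X' Y', X = x * X' - e * y * Y' ∧ Y = y * X' + d * x * Y' := by
    refine ⟨(d * x * X + e * y * Y) / s, (x * Y - y * X) / s, ?_, ?_⟩
    · field_simp; rw [← hs]; ring
    · field_simp; rw [← hs]; ring
  refine ⟨?_, fun z => ?_⟩
  · rw [diagIso_cons_cons, diagIso_cons_cons]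
    refine or_congr_right ⟨?_, ?_⟩
    · rintro ⟨X, Y, hXY, h⟩
      obtain ⟨X', Y', rfl, rfl⟩ := inv X Y
      refine ⟨X', Y', ?_, by rwa [← key]⟩
      by_contra! h0
      simp [h0.1, h0.2] at hXY
    · rintro ⟨X, Y, hXY, h⟩
      refine ⟨_, _, ?_, by rwa [key]⟩
      by_contra! h0
      have h1 : s * X = 0 := by rw [← hs]; linear_combination d * x * h0.1 + e * y * h0.2
      have h2 : s * Y = 0 := by rw [← hs]; linear_combination x * h0.2 - y * h0.1
      simp_all
  · rw [diagRep_cons_cons, diagRep_cons_cons]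
    constructor
    · rintro ⟨X, Y, h⟩
      obtain ⟨X', Y', rfl, rfl⟩ := inv X Y
      exact ⟨X', Y', by rwa [← key]⟩
    · rintro ⟨X, Y, h⟩
      exact ⟨_, _, by rwa [key]⟩

end SameValues

theorem diagRep_append (l l' : List K) (z : K) :
    DiagRep (l ++ l') z ↔ ∃ y, DiagRep l y ∧ DiagRep l' (z - y) := by
  induction l generalizing z with
  | nil => simp [DiagRep]
  | cons d l ih =>
    simp only [List.cons_append, DiagRep, ih]
    constructor
    · rintro ⟨x, y, h, h'⟩
      exact ⟨y + d * x ^ 2, ⟨x, by simpa using h⟩, by convert h' using 1; ring⟩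
    · rintro ⟨y, ⟨x, h⟩, h'⟩
      exact ⟨x, _, h, by convert h' using 1; ring⟩

theorem diagIso_append (l l' : List K) :
    DiagIso (l ++ l') ↔
      DiagIso l ∨ DiagIso l' ∨ ∃ y, y ≠ 0 ∧ DiagRep l y ∧ DiagRep l' (-y) := by
  induction l with
  | nil => simp +contextual [DiagIso, DiagRep]
  | cons d l ih =>
    simp only [List.cons_append, DiagIso, ih, diagRep_append, DiagRep]
    constructor
    · rintro ((h | h | ⟨y, hy, h, h'⟩) | ⟨x, hx, y, h, h'⟩)
      · exact Or.inl (Or.inl h)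
      · exact Or.inr (Or.inl h)
      · exact Or.inr (Or.inr ⟨y, hy, ⟨0, by simpa using h⟩, h'⟩)
      · by_cases h0 : y + d * x ^ 2 = 0
        · exact Or.inl (Or.inr ⟨x, hx, by rwa [← eq_neg_of_add_eq_zero_left h0]⟩)
        · exact Or.inr (Or.inr ⟨_, h0, ⟨x, by simpa using h⟩, by convert h' using 1; ring⟩)
    · rintro ((h | ⟨x, hx, h⟩) | h | ⟨y, hy, ⟨x, h⟩, h'⟩)
      · exact Or.inl (Or.inl h)
      · exact Or.inr ⟨x, hx, _, h, by simpa using DiagRep.zero l'⟩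
      · exact Or.inl (Or.inr (Or.inl h))
      · by_cases hx : x = 0
        · subst hx
          exact Or.inl (Or.inr (Or.inr ⟨y, hy, by simpa using h, h'⟩))
        · exact Or.inr ⟨x, hx, _, h, by convert h' using 1; ring⟩

theorem diagRep_map_mul {c : K} (hc : c ≠ 0) (l : List K) (z : K) :
    DiagRep (l.map (c * ·)) (c * z) ↔ DiagRep l z := by
  induction l generalizing z with
  | nil => simp [DiagRep, hc]
  | cons d l ih =>
    simp only [List.map_cons, DiagRep, ← ih, mul_sub, mul_assoc]

theorem diagIso_map_mul {c : K} (hc : c ≠ 0) (l : List K) :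
    DiagIso (l.map (c * ·)) ↔ DiagIso l := by
  induction l with
  | nil => simp [DiagIso]
  | cons d l ih =>
    simp only [List.map_cons, DiagIso, ← ih, ← diagRep_map_mul hc l, mul_neg, mul_assoc]

theorem DiagRep.map {E : Type*} [Field E] (f : K →+* E) {l : List K} {z : K}
    (h : DiagRep l z) : DiagRep (l.map f) (f z) := by
  induction l generalizing z with
  | nil => simpa [DiagRep] using h
  | cons d l ih =>
    obtain ⟨x, hx⟩ := h
    exact ⟨f x, by simpa using ih hx⟩

theorem DiagIso.map {E : Type*} [Field E] (f : K →+* E) {l : List K}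
    (h : DiagIso l) : DiagIso (l.map f) := by
  induction l with
  | nil => exact h
  | cons d l ih =>
    obtain h | ⟨x, hx, h⟩ := h
    · exact Or.inl (ih h)
    · exact Or.inr ⟨f x, by simpa using hx, by simpa using h.map f⟩

end DiagonalForms

section Pfister

variable {K : Type u} [Field K]

/-- The diagonal coefficients of the Pfister form with the given slots. -/
def pfisterList : List K → List K
  | [] => [1]
  | a :: as => pfisterList as ++ (pfisterList as).map (-a * ·)

theorem pfisterList_eq_cons (as : List K) : ∃ l, pfisterList as = 1 :: l := by
  induction as with
  | nil => exact ⟨[], rfl⟩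
  | cons a as ih =>
    obtain ⟨l, hl⟩ := ih
    exact ⟨l ++ (pfisterList as).map (-a * ·), by simp [pfisterList, hl]⟩

theorem map_pfisterList {E : Type u} [Field E] (f : K →+* E) (as : List K) :
    (pfisterList as).map f = pfisterList (as.map f) := by
  induction as with
  | nil => simp [pfisterList]
  | cons a as ih => simp [pfisterList, ← ih, Function.comp_def]

/-- A quadratic form is round if each of its values is the multiplier of a similarity
whose square is scalar. -/
def IsRound {V : Type*} [AddCommGroup V] [Module K V] (ρ : QuadraticForm K V) : Prop :=
  ∀ w, ∃ M : V →ₗ[K] V, (∀ v, M (M v) = ρ w • v) ∧ ∀ v, ρ (M v) = ρ w * ρ v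

theorem IsRound.exists_selfAdjoint {V : Type*} [AddCommGroup V] [Module K V]
    {ρ : QuadraticForm K V} (h : IsRound ρ) (w : V) :
    ∃ M : V →ₗ[K] V, (∀ v, M (M v) = ρ w • v) ∧ (∀ v, ρ (M v) = ρ w * ρ v) ∧
      ∀ x y, QuadraticMap.polar ρ (M x) y = QuadraticMap.polar ρ x (M y) := by
  by_cases hw : ρ w = 0
  · exact ⟨0, by simp [hw], by simp [hw], by simp⟩
  obtain ⟨M, h1, h2⟩ := h w
  refine ⟨M, h1, h2, fun x y => mul_left_cancel₀ hw ?_⟩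
  have h3 (a b : V) : QuadraticMap.polar ρ (M a) (M b) = ρ w * QuadraticMap.polar ρ a b := by
    simp only [QuadraticMap.polar, ← map_add, h2]; ring
  rw [← h3, h1, QuadraticMap.polar_smul_left, smul_eq_mul]

theorem IsRound.prod_smul {V : Type*} [AddCommGroup V] [Module K V]
    {ρ : QuadraticForm K V} (h : IsRound ρ) (c : K) : IsRound (ρ.prod (c • ρ)) := by
  rintro ⟨w₁, w₂⟩
  obtain ⟨M₁, h1, h1', h1''⟩ := h.exists_selfAdjoint w₁
  obtain ⟨M₂, h2, h2'⟩ := h w₂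
  by_cases hw : ρ w₂ = 0
  · refine ⟨M₁.prodMap M₁, fun v => ?_, fun v => ?_⟩
    · ext <;> simp [h1, hw]
    · simp [h1', hw]; ring
  · obtain ⟨M, hM⟩ : ∃ M : V × V →ₗ[K] V × V, ∀ v₁ v₂, M (v₁, v₂) =
        (M₁ v₁ + (-c) • M₂ v₂, -M₂ (v₁ + (ρ w₂)⁻¹ • M₁ (M₂ v₂))) :=
      ⟨((M₁ ∘ₗ .fst K V V) + (-c) • (M₂ ∘ₗ .snd K V V)).prod
        (-(M₂ ∘ₗ (.fst K V V + (ρ w₂)⁻¹ • (M₁ ∘ₗ M₂ ∘ₗ .snd K V V)))), fun _ _ => rfl⟩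
    refine ⟨M, ?_, ?_⟩
    · rintro ⟨v₁, v₂⟩
      simp only [hM, map_add, map_neg, map_smul, h1, h2, QuadraticMap.prod_apply, smul_apply,
        smul_add, smul_neg, smul_smul, Prod.smul_mk, inv_mul_cancel₀ hw, smul_eq_mul]
      ext
      · simp only
        module
      · simp only
        match_scalars <;> field_simp <;> ring
    · rintro ⟨v₁, v₂⟩
      simp only [hM, QuadraticMap.prod_apply, smul_apply, QuadraticMap.map_neg, h2',
        QuadraticMap.map_add ρ, QuadraticMap.map_smul, map_smul, QuadraticMap.polar_smul_right, h1', h1'',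
        smul_eq_mul]
      field_simp
      ring

theorem pfisterList_round (as : List K) (has : ∀ a ∈ as, a ≠ 0) :
    ∃ (V : Type u) (_ : AddCommGroup V) (_ : Module K V) (ρ : QuadraticForm K V), IsRound ρ ∧
      ∀ z, DiagRep (pfisterList as) z ↔ ∃ v, ρ v = z := by
  induction as with
  | nil =>
    refine ⟨K, inferInstance, inferInstance, QuadraticMap.sq, fun w =>
      ⟨LinearMap.mulLeft K w, fun v => ?_, fun v => ?_⟩, fun z => ?_⟩
    · simp [mul_assoc]
    · simp; ring
    · simp [pfisterList, DiagRep, sub_eq_zero, sq, eq_comm]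
  | cons a as ih =>
    obtain ⟨V, _, _, ρ, hρ, h⟩ := ih fun b hb => has b (List.mem_cons_of_mem _ hb)
    have ha : -a ≠ 0 := neg_ne_zero.2 (has a List.mem_cons_self)
    refine ⟨V × V, inferInstance, inferInstance, ρ.prod (-a • ρ), hρ.prod_smul _, fun z => ?_⟩
    have hz (y : K) : DiagRep ((pfisterList as).map (-a * ·)) (z - y) ↔
        ∃ v, ρ v = (-a)⁻¹ * (z - y) := by
      rw [← h, ← diagRep_map_mul ha (pfisterList as), mul_inv_cancel_left₀ ha]
    simp only [pfisterList, diagRep_append, h, hz, Prod.exists, QuadraticMap.prod_apply,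
      smul_apply, smul_eq_mul]
    constructor
    · rintro ⟨_, ⟨v, rfl⟩, w, hw⟩
      exact ⟨v, w, by rw [hw, mul_inv_cancel_left₀ ha]; ring⟩
    · rintro ⟨v, w, rfl⟩
      exact ⟨_, ⟨v, rfl⟩, w, by rw [add_sub_cancel_left, inv_mul_cancel_left₀ ha]⟩

theorem DiagRep.pfister_div {as : List K} (has : ∀ a ∈ as, a ≠ 0) {y z : K}
    (hy : DiagRep (pfisterList as) y) (hz : DiagRep (pfisterList as) z) (hz0 : z ≠ 0) :
    DiagRep (pfisterList as) (y / z) := by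
  obtain ⟨V, _, _, ρ, hρ, h⟩ := pfisterList_round as has
  rw [h] at hy hz ⊢
  obtain ⟨v, rfl⟩ := hy
  obtain ⟨w, rfl⟩ := hz
  obtain ⟨M, -, hM⟩ := hρ w
  refine ⟨(ρ w)⁻¹ • M v, ?_⟩
  rw [QuadraticMap.map_smul, hM, smul_eq_mul]
  field_simp

/-- If `⟨⟨a, a₁, …, aₙ⟩⟩` is isotropic but `⟨⟨a₁, …, aₙ⟩⟩` is not, then the latter
represents `a`. -/
theorem DiagIso.pfister_cons {a : K} {as : List K} (ha : a ≠ 0) (has : ∀ b ∈ as, b ≠ 0)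
    (h : DiagIso (pfisterList (a :: as))) :
    DiagIso (pfisterList as) ∨ DiagRep (pfisterList as) a := by
  have ha' : -a ≠ 0 := neg_ne_zero.2 ha
  rw [pfisterList, diagIso_append, diagIso_map_mul ha'] at h
  obtain h | h | ⟨y, hy, h, h'⟩ := h
  · exact Or.inl h
  · exact Or.inl h
  · right
    have h'' : DiagRep (pfisterList as) (y / a) := by
      rw [← diagRep_map_mul ha']
      convert h' using 1
      field_simp
    simpa [div_div_cancel₀ hy] using h.pfister_div has h'' (div_ne_zero hy ha)

end Pfister

section CasselsPfister

open Polynomial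

variable {K E : Type*} [Field K] [Field E]

/-- The field `E` is, via `i`, the rational function field over `K` in the variable `x`. -/
structure IsRationalExtension (i : K →+* E) (x : E) : Prop where
  eq_zero_of_eval₂ : ∀ p : K[X], p.eval₂ i x = 0 → p = 0
  exists_eval₂_div : ∀ z : E, ∃ p q : K[X], q ≠ 0 ∧ z * q.eval₂ i x = p.eval₂ i x

theorem IsRationalExtension.exists_common_denom {i : K →+* E} {x : E}
    (hx : IsRationalExtension i x) {n : ℕ} (v : Fin n → E) :
    ∃ (h : K[X]) (V : Fin n → K[X]), h ≠ 0 ∧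
      ∀ k, v k * eval₂RingHom i x h = eval₂RingHom i x (V k) := by
  choose p q hq hpq using fun k => hx.exists_eval₂_div (v k)
  refine ⟨∏ k, q k, fun k => p k * ∏ j ∈ Finset.univ.erase k, q j,
    Finset.prod_ne_zero_iff.2 fun k _ => hq k, fun k => ?_⟩
  rw [← Finset.mul_prod_erase _ _ (Finset.mem_univ k), map_mul, map_mul, ← mul_assoc]
  simp only [coe_eval₂RingHom, hpq]

theorem sum_mul_sq_linearCombination {R ι : Type*} [CommRing R] [Fintype ι] (w V W : ι → R)
    (a b : R) :
    ∑ k, w k * (a * V k + b * W k) ^ 2 =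
      a ^ 2 * ∑ k, w k * V k ^ 2 + 2 * a * b * ∑ k, w k * (V k * W k) +
        b ^ 2 * ∑ k, w k * W k ^ 2 := by
  simp only [Finset.mul_sum, ← Finset.sum_add_distrib]
  exact Finset.sum_congr rfl fun k _ => by ring

theorem coeff_sum_C_mul_sq {n : ℕ} (w : Fin n → K) {V : Fin n → K[X]} {M : ℕ}
    (hV : ∀ k, (V k).natDegree ≤ M) :
    (∑ k, C (w k) * V k ^ 2).coeff (2 * M) = ∑ k, w k * (V k).coeff M ^ 2 := by
  simp only [finsetSum_coeff, coeff_C_mul, coeff_pow_of_natDegree_le (hV _)]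

theorem natDegree_le_of_anisotropic {n : ℕ} {w : Fin n → K}
    (hw : ∀ v : Fin n → K, ∑ k, w k * v k ^ 2 = 0 → v = 0) {V : Fin n → K[X]} {N : ℕ}
    (hV : (∑ k, C (w k) * V k ^ 2).natDegree ≤ 2 * N) (k : Fin n) : (V k).natDegree ≤ N := by
  by_contra! hk
  obtain ⟨m, -, hm⟩ := Finset.exists_max_image Finset.univ (fun k => (V k).natDegree)
    ⟨k, Finset.mem_univ k⟩
  have hlt : N < (V m).natDegree := hk.trans_le (hm k (Finset.mem_univ k))
  have h0 := coeff_sum_C_mul_sq w fun j => hm j (Finset.mem_univ j)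
  rw [coeff_eq_zero_of_natDegree_lt (by omega)] at h0
  have h1 := congrFun (hw _ h0.symm) m
  simp only [coeff_natDegree, Pi.zero_apply, leadingCoeff_eq_zero] at h1
  simp [h1] at hlt

theorem eq_zero_of_sum_C_mul_sq_eq_zero {n : ℕ} {w : Fin n → K}
    (hw : ∀ v : Fin n → K, ∑ k, w k * v k ^ 2 = 0 → v = 0) {V : Fin n → K[X]}
    (hV : ∑ k, C (w k) * V k ^ 2 = 0) : V = 0 := by
  have hdeg (k : Fin n) : (V k).natDegree ≤ 0 :=
    natDegree_le_of_anisotropic hw (N := 0) (by simp [hV]) k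
  have h0 := coeff_sum_C_mul_sq w hdeg
  rw [hV, coeff_zero] at h0
  ext1 k
  rw [eq_C_of_natDegree_le_zero (hdeg k)]
  simpa using congrFun (hw _ h0.symm) k

/-- **Cassels–Pfister theorem** for diagonal forms. -/
theorem exists_polynomial_representation {n : ℕ} {w : Fin n → K}
    (hw : ∀ v : Fin n → K, ∑ k, w k * v k ^ 2 = 0 → v = 0) {f : K[X]} (h : K[X]) (hh : h ≠ 0)
    (V : Fin n → K[X]) (hV : ∑ k, C (w k) * V k ^ 2 = h ^ 2 * f) :
    ∃ W : Fin n → K[X], ∑ k, C (w k) * W k ^ 2 = f := by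
  induction hd : h.natDegree using Nat.strong_induction_on generalizing h V with
  | _ N ih =>
  subst hd
  set W : Fin n → K[X] := fun k => V k / h with hW
  set R : Fin n → K[X] := fun k => V k % h with hR
  have hdiv (k : Fin n) : 1 * V k + (-h) * W k = R k := by
    have := EuclideanDomain.div_add_mod (V k) h
    simp only [hW, hR]; linear_combination -this
  have hQR := sum_mul_sq_linearCombination (fun k => C (w k)) V W 1 (-h)
  simp only [hdiv] at hQR
  set B := ∑ k, C (w k) * (V k * W k)
  set S := ∑ k, C (w k) * W k ^ 2 with hS
  by_cases hR0 : R = 0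
  · refine ⟨W, mul_left_cancel₀ (pow_ne_zero 2 hh) ?_⟩
    rw [← hV, ← hS]
    have hVW (k : Fin n) : V k = h * W k := by
      have := hdiv k
      simp only [hR0, Pi.zero_apply] at this
      linear_combination this
    rw [hS, Finset.mul_sum]
    exact Finset.sum_congr rfl fun k _ => by rw [hVW]; ring
  · have hQR0 : ∑ k, C (w k) * R k ^ 2 ≠ 0 := fun h0 =>
      hR0 (eq_zero_of_sum_C_mul_sq_eq_zero hw h0)
    set h' := h * S - 2 * B + h * f with hh'
    have hmul : ∑ k, C (w k) * R k ^ 2 = h * h' := by rw [hQR, hV, hh']; ring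
    have hh'0 : h' ≠ 0 := by
      rintro h0
      rw [h0, mul_zero] at hmul
      exact hQR0 hmul
    have hpos : h.natDegree ≠ 0 := by
      intro h0
      refine hR0 (funext fun k => ?_)
      rw [hR, eq_C_of_natDegree_eq_zero h0]
      refine EuclideanDomain.mod_eq_zero.2 (IsUnit.dvd (isUnit_C.2 (IsUnit.mk0 _ ?_)))
      rintro h1
      exact hh (by rw [eq_C_of_natDegree_eq_zero h0, h1, C_0])
    have hdeg : (∑ k, C (w k) * R k ^ 2).natDegree ≤ 2 * (h.natDegree - 1) := by
      refine natDegree_sum_le_of_forall_le _ _ fun k _ => (natDegree_C_mul_le _ _).trans ?_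
      refine natDegree_pow_le.trans (Nat.mul_le_mul_left 2 ?_)
      have := natDegree_mod_lt (V k) hpos
      simp only [hR]; omega
    rw [hmul, natDegree_mul hh hh'0] at hdeg
    refine ih _ (by omega) h' hh'0
      (fun k => (S - f) * V k + 2 * (h * f - B) * W k) ?_ rfl
    rw [sum_mul_sq_linearCombination (fun k => C (w k)), hV, ← hS, hh']
    ring

theorem coeff_eq_of_quadratic_eq {α β γ δ ε : K}
    (h : C α * X ^ 2 + C β * X + C γ = C δ * X ^ 2 + C ε) : α = δ ∧ β = 0 ∧ γ = ε := by
  have hc (k : ℕ) := congrArg (coeff · k) h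
  exact ⟨by simpa [coeff_X, coeff_C] using hc 2, by simpa [coeff_X, coeff_C] using hc 1,
    by simpa [coeff_X, coeff_C] using hc 0⟩

/-- If an anisotropic diagonal form `⟨w₀, …, wₙ⟩` represents `w₀ x² + e` over `K(x)`, then
`⟨w₁, …, wₙ⟩` represents `e` over `K`. -/
theorem IsRationalExtension.cancel {i : K →+* E} {x : E} (hx : IsRationalExtension i x)
    (h2 : (2 : K) ≠ 0) {n : ℕ} {w : Fin (n + 1) → K}
    (hw : ∀ v : Fin (n + 1) → K, ∑ k, w k * v k ^ 2 = 0 → v = 0) {e : K} {v : Fin (n + 1) → E}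
    (hv : ∑ k, i (w k) * v k ^ 2 = i (w 0) * x ^ 2 + i e) :
    ∃ u : Fin (n + 1) → K, u 0 = 0 ∧ ∑ k, w k * u k ^ 2 = e := by
  obtain ⟨h, V, hh, hV⟩ := hx.exists_common_denom v
  obtain ⟨W, hW⟩ := exists_polynomial_representation hw (f := C (w 0) * X ^ 2 + C e) h hh V (by
    refine sub_eq_zero.1 (hx.eq_zero_of_eval₂ _ ?_)
    rw [← coe_eval₂RingHom, map_sub, sub_eq_zero]
    simp only [map_sum, map_mul, map_pow, ← hV, map_add]
    simp only [coe_eval₂RingHom, eval₂_C, eval₂_X, ← hv, Finset.mul_sum]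
    exact Finset.sum_congr rfl fun k _ => by ring)
  have hdeg (k : Fin (n + 1)) : (W k).natDegree ≤ 1 :=
    natDegree_le_of_anisotropic hw (N := 1) (by rw [hW]; compute_degree) k
  have hlin (k : Fin (n + 1)) : W k = X * C ((W k).coeff 1) + 1 * C ((W k).coeff 0) := by
    conv_lhs => rw [eq_X_add_C_of_natDegree_le_one (hdeg k)]
    ring
  set u : Fin (n + 1) → K := fun k => (W k).coeff 1
  set t : Fin (n + 1) → K := fun k => (W k).coeff 0
  have hsum : ∑ k, C (w k) * W k ^ 2 =
      C (∑ k, w k * u k ^ 2) * X ^ 2 + C (2 * ∑ k, w k * (u k * t k)) * X +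
        C (∑ k, w k * t k ^ 2) := by
    have := sum_mul_sq_linearCombination (fun k => C (w k)) (fun k => C (u k))
      (fun k => C (t k)) X 1
    simp only [u, t, ← hlin] at this
    rw [this]
    simp only [map_sum, map_mul, map_pow, map_ofNat, u, t]
    ring
  rw [hsum] at hW
  obtain ⟨c2, c1, c0⟩ := coeff_eq_of_quadratic_eq hW
  replace c1 := (mul_eq_zero.1 c1).resolve_left h2
  have hw0 : w 0 ≠ 0 := fun h0 => by
    have := congrFun (hw (Pi.single 0 1) (by
      rw [Finset.sum_eq_single 0] <;> simp +contextual [h0])) 0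
    simp at this
  let δ : Fin (n + 1) → K := Pi.single 0 1
  have hδ (y : Fin (n + 1) → K) : ∑ k, w k * (y k * δ k) = w 0 * y 0 := by
    rw [Finset.sum_eq_single 0] <;> simp +contextual [δ]
  have hδ2 : ∑ k, w k * δ k ^ 2 = w 0 := by
    simpa [sq, δ] using hδ δ
  by_cases hu : u = δ
  · refine ⟨t, ?_, c0⟩
    have := hδ t
    rw [← hu] at this
    simp only [mul_comm (t _), c1] at this
    simpa [hw0] using this.symm
  · have hz : w 0 * (2 * (1 - u 0)) ≠ 0 := fun h0 => hu <| sub_eq_zero.1 <| hw _ <| by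
      have := sum_mul_sq_linearCombination w u δ 1 (-1)
      rw [c2, hδ, hδ2] at this
      simp only [Pi.sub_apply]
      rw [← h0, ← sub_eq_zero]
      convert sub_eq_zero.2 this using 2
      · simp [sub_eq_add_neg]
      · ring
    have hu0 : 1 - u 0 ≠ 0 := by
      rintro h0
      simp [h0] at hz
    refine ⟨fun k => 1 * t k + t 0 / (1 - u 0) * (u k - δ k), ?_, ?_⟩
    · simp only [δ, Pi.single_eq_same]; field_simp; ring
    · have e1 : ∑ k, w k * (t k * (u k - δ k)) = - (w 0 * t 0) := by
        simp only [mul_sub, Finset.sum_sub_distrib, hδ, mul_comm (t _) (u _), c1, zero_sub]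
      have e2 : ∑ k, w k * (u k - δ k) ^ 2 = w 0 * (2 * (1 - u 0)) := by
        have := sum_mul_sq_linearCombination w u δ 1 (-1)
        rw [c2, hδ, hδ2] at this
        simp only [sub_eq_add_neg, one_mul, neg_mul] at this ⊢
        rw [this]; ring
      rw [sum_mul_sq_linearCombination w t (fun k => u k - δ k), c0, e1, e2]
      field_simp
      ring

theorem not_diagIso_ofFn {n : ℕ} {w : Fin n → K} :
    ¬ DiagIso (List.ofFn w) ↔ ∀ v : Fin n → K, ∑ k, w k * v k ^ 2 = 0 → v = 0 := by
  rw [diagIso_ofFn]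
  push Not
  exact forall_congr' fun v => ⟨fun h h0 => by_contra fun hv => h hv h0,
    fun h hv h0 => hv (h h0)⟩

theorem IsRationalExtension.diagIso_of_map {i : K →+* E} {x : E} (hx : IsRationalExtension i x)
    {l : List K} (h : DiagIso (l.map i)) : DiagIso l := by
  obtain ⟨n, w, rfl⟩ : ∃ (n : ℕ) (w : Fin n → K), l = List.ofFn w :=
    ⟨_, l.get, (List.ofFn_get l).symm⟩
  by_contra hw
  rw [not_diagIso_ofFn] at hw
  rw [List.map_ofFn, diagIso_ofFn] at h
  obtain ⟨v, hv0, hv⟩ := h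
  obtain ⟨h, V, hh, hV⟩ := hx.exists_common_denom v
  have hV0 : V = 0 := eq_zero_of_sum_C_mul_sq_eq_zero hw <| hx.eq_zero_of_eval₂ _ <| by
    rw [← coe_eval₂RingHom]
    simp only [map_sum, map_mul, map_pow, ← hV]
    simp only [coe_eval₂RingHom, eval₂_C, mul_pow, ← mul_assoc]
    rw [← Finset.sum_mul]
    exact mul_eq_zero_of_left hv _
  refine hv0 (funext fun k => ?_)
  have := hV k
  rw [hV0, Pi.zero_apply, map_zero] at this
  exact (mul_eq_zero.1 this).resolve_right fun h0 => hh (hx.eq_zero_of_eval₂ _ h0)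

theorem IsRationalExtension.diagRep_cancel {i : K →+* E} {x : E}
    (hx : IsRationalExtension i x) (h2 : (2 : K) ≠ 0) {d e : K} {l : List K}
    (hl : ¬ DiagIso (d :: l)) (h : DiagRep ((d :: l).map i) (i d * x ^ 2 + i e)) :
    DiagRep l e := by
  obtain ⟨n, w, hw⟩ : ∃ (n : ℕ) (w : Fin (n + 1) → K), d :: l = List.ofFn w :=
    ⟨_, (d :: l).get, (List.ofFn_get _).symm⟩
  obtain ⟨rfl, rfl⟩ := List.cons.inj (hw.trans List.ofFn_succ)
  rw [hw, not_diagIso_ofFn] at hl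
  rw [hw, List.map_ofFn, diagRep_ofFn] at h
  obtain ⟨v, hv⟩ := h
  obtain ⟨u, hu0, hu⟩ := hx.cancel h2 hl hv
  rw [diagRep_ofFn]
  exact ⟨fun k => u k.succ, by simpa [Fin.sum_univ_succ, hu0] using hu⟩

end CasselsPfister

section Tower

open MvPolynomial

/-- The embedding `L(x₁, …, xₘ) → L(x₀, …, xₘ)`. -/
def stepHom (L : Type*) [Field L] (m : ℕ) :
    FractionRing (MvPolynomial (Fin m) L) →+* FractionRing (MvPolynomial (Fin (m + 1)) L) :=
  IsFractionRing.lift (g := (algebraMap (MvPolynomial (Fin (m + 1)) L)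
      (FractionRing (MvPolynomial (Fin (m + 1)) L))).comp (rename Fin.succ).toRingHom)
    ((IsFractionRing.injective (MvPolynomial (Fin (m + 1)) L)
        (FractionRing (MvPolynomial (Fin (m + 1)) L))).comp
      (rename_injective _ (Fin.succ_injective m)))

/-- The new variable `x₀` of `L(x₀, …, xₘ)` over `L(x₁, …, xₘ)`. -/
def stepVar (L : Type*) [Field L] (m : ℕ) : FractionRing (MvPolynomial (Fin (m + 1)) L) :=
  algebraMap (MvPolynomial (Fin (m + 1)) L) _ (X 0)

variable {L : Type*} [Field L] {m : ℕ}

theorem stepHom_algebraMap (p : MvPolynomial (Fin m) L) :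
    stepHom L m (algebraMap _ _ p) = algebraMap _ _ (rename Fin.succ p) :=
  IsFractionRing.lift_algebraMap _ p

theorem stepHom_comp_toFrac : (stepHom L m).comp (toFrac L m) = toFrac L (m + 1) := by
  ext a
  simp [toFrac, stepHom_algebraMap]

theorem eval₂_map_stepHom (P : Polynomial (MvPolynomial (Fin m) L)) :
    (P.map (algebraMap _ (FractionRing (MvPolynomial (Fin m) L)))).eval₂ (stepHom L m)
      (stepVar L m) = algebraMap _ _ ((finSuccEquiv L m).symm P) := by
  obtain ⟨p, rfl⟩ := (finSuccEquiv L m).surjective P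
  rw [AlgEquiv.symm_apply_apply, Polynomial.eval₂_map]
  induction p using MvPolynomial.induction_on with
  | C a =>
    simp [finSuccEquiv_apply, stepHom_algebraMap]
  | add p q hp hq => simp only [map_add, Polynomial.eval₂_add, hp, hq]
  | mul_X p i hp =>
    rw [map_mul, Polynomial.eval₂_mul, hp, map_mul]
    congr 1
    refine Fin.cases ?_ (fun j => ?_) i
    · simp [finSuccEquiv_X_zero, stepVar]
    · simp [finSuccEquiv_X_succ, stepHom_algebraMap]

theorem isRationalExtension_stepHom :
    IsRationalExtension (stepHom L m) (stepVar L m) where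
  eq_zero_of_eval₂ p hp := by
    obtain ⟨b, hb, h⟩ :=
      IsLocalization.integerNormalization_spec (nonZeroDivisors (MvPolynomial (Fin m) L)) p
    have h0 := eval₂_map_stepHom
      (IsLocalization.integerNormalization (nonZeroDivisors (MvPolynomial (Fin m) L)) p)
    rw [h, algebra_compatible_smul (FractionRing (MvPolynomial (Fin m) L)) b p,
      Polynomial.eval₂_smul, hp, mul_zero, eq_comm,
      map_eq_zero_iff _ (IsFractionRing.injective _ _), map_eq_zero_iff _ (AlgEquiv.injective _),
      IsLocalization.integerNormalization_eq_zero_iff le_rfl] at h0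
    exact h0
  exists_eval₂_div z := by
    obtain ⟨a, b, hb, rfl⟩ := IsFractionRing.div_surjective (A := MvPolynomial (Fin (m + 1)) L) z
    have hb0 : b ≠ 0 := nonZeroDivisors.ne_zero hb
    refine ⟨(finSuccEquiv L m a).map (algebraMap _ _), (finSuccEquiv L m b).map (algebraMap _ _),
      ?_, ?_⟩
    · rw [Polynomial.map_ne_zero_iff (IsFractionRing.injective _ _)]
      simpa using hb0
    · rw [eval₂_map_stepHom, eval₂_map_stepHom, AlgEquiv.symm_apply_apply,
        AlgEquiv.symm_apply_apply, div_mul_cancel₀]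
      exact (map_ne_zero_iff _ (IsFractionRing.injective _ _)).2 hb0

theorem diagIso_of_map_toFrac_zero {l : List L} (h : DiagIso (l.map (toFrac L 0))) : DiagIso l := by
  let g : FractionRing (MvPolynomial (Fin 0) L) →+* L :=
    IsFractionRing.lift (g := (isEmptyAlgEquiv L (Fin 0)).toRingEquiv.toRingHom)
      (isEmptyAlgEquiv L (Fin 0)).injective
  have := h.map g
  rw [List.map_map] at this
  convert this
  refine (List.map_id l).symm.trans (List.map_congr_left fun a _ => ?_)
  exact ((IsFractionRing.lift_algebraMap _ (C a)).trans
    ((isEmptyAlgEquiv L (Fin 0)).commutes a)).symm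

variable (F : Type*) [Field F] (L : Type*) [Field L] [Algebra F L] (m : ℕ)

theorem transMap_algebraMap (p : MvPolynomial (Fin m) F) :
    transMap F L m (algebraMap _ _ p) = algebraMap _ _ (MvPolynomial.map (algebraMap F L) p) :=
  IsFractionRing.lift_algebraMap _ p

theorem transMap_comp_toFrac :
    (transMap F L m).comp (toFrac F m) = (toFrac L m).comp (algebraMap F L) := by
  ext a
  simp [toFrac, transMap_algebraMap]

theorem transMap_stepVar : transMap F L (m + 1) (stepVar F m) = stepVar L m := by
  simp [stepVar, transMap_algebraMap]

theorem transMap_comp_stepHom :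
    (transMap F L (m + 1)).comp (stepHom F m) = (stepHom L m).comp (transMap F L m) := by
  refine IsLocalization.ringHom_ext (nonZeroDivisors (MvPolynomial (Fin m) F)) ?_
  ext a
  · simp [transMap_algebraMap, stepHom_algebraMap]
  · simp [transMap_algebraMap, stepHom_algebraMap]

end Tower

section Control

/-- The rational function field `L(x₁, …, xₘ)`. -/
abbrev RatFun (L : Type u) [Field L] (m : ℕ) : Type u := FractionRing (MvPolynomial (Fin m) L)

/-- A family of embeddings `L(x₁, …, xₘ) → L(x₁, …, xₙ)`, natural in `L`, that reflects isotropy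
of diagonal forms. -/
structure TowerHom (m n : ℕ) where
  /-- The embedding over a given base field. -/
  hom (L : Type u) [Field L] : RatFun L m →+* RatFun L n
  hom_toFrac (L : Type u) [Field L] (a : L) : hom L (toFrac L m a) = toFrac L n a
  transMap_hom (F L : Type u) [Field F] [Field L] [Algebra F L] (z : RatFun F m) :
    transMap F L n (hom F z) = hom L (transMap F L m z)
  diagIso_of_map (L : Type u) [Field L] {l : List (RatFun L m)} :
    DiagIso (l.map (hom L)) → DiagIso l

/-- The identity tower embedding. -/
def TowerHom.refl (m : ℕ) : TowerHom.{u} m m where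
  hom L _ := RingHom.id _
  hom_toFrac _ _ _ := rfl
  transMap_hom _ _ _ _ _ _ := rfl
  diagIso_of_map L _ l h := by simpa using h

/-- Adjoin a new variable, then apply a tower embedding. -/
def TowerHom.precompStep {m n : ℕ} (J : TowerHom.{u} (m + 1) n) : TowerHom.{u} m n where
  hom L _ := (J.hom L).comp (stepHom L m)
  hom_toFrac L _ a := by
    rw [RingHom.comp_apply, ← J.hom_toFrac, ← stepHom_comp_toFrac, RingHom.comp_apply]
  transMap_hom F L _ _ _ z := by
    rw [RingHom.comp_apply, J.transMap_hom, RingHom.comp_apply]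
    exact congrArg _ (RingHom.congr_fun (transMap_comp_stepHom F L m) z)
  diagIso_of_map L _ l h := by
    refine isRationalExtension_stepHom.diagIso_of_map (J.diagIso_of_map L ?_)
    rwa [List.map_map]

/-- Two diagonal forms take the same values and are simultaneously isotropic over every
extension field. -/
def DiagEquiv {K : Type u} [Field K] (l l' : List K) : Prop :=
  ∀ (E : Type u) [Field E] (f : K →+* E), SameValues (l.map f) (l'.map f)

namespace DiagEquiv

variable {K : Type u} [Field K] {l l' l'' : List K}

theorem of_perm (h : l.Perm l') : DiagEquiv l l' := fun _ _ f => .of_perm (h.map f)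

theorem trans (h : DiagEquiv l l') (h' : DiagEquiv l' l'') : DiagEquiv l l'' :=
  fun E _ f => (h E f).trans (h' E f)

theorem append_left (p : List K) (h : DiagEquiv l l') : DiagEquiv (p ++ l) (p ++ l') :=
  fun E _ f => by simpa using (h E f).append_left (p.map f)

theorem append_right (p : List K) (h : DiagEquiv l l') : DiagEquiv (l ++ p) (l' ++ p) :=
  fun E _ f => by simpa using (h E f).append_right (p.map f)

theorem binary {d e s x y : K} (hs : d * x ^ 2 + e * y ^ 2 = s) (hs0 : s ≠ 0) (l : List K) :
    DiagEquiv (d :: e :: l) (s :: d * e * s :: l) := fun E _ f => by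
  have := SameValues.binary (d := f d) (e := f e) (x := f x) (y := f y) (s := f s)
    (by simp [← hs]) (by simpa using hs0) (l.map f)
  simpa using this

theorem map {E : Type u} [Field E] (f : K →+* E) (h : DiagEquiv l l') :
    DiagEquiv (l.map f) (l'.map f) := fun E' _ g => by
  simpa only [List.map_map, RingHom.coe_comp] using h E' (g.comp f)

end DiagEquiv

theorem IsRationalExtension.sub_mul_sq_ne_zero {K E : Type*} [Field K] [Field E] {i : K →+* E}
    {x : E} (hx : IsRationalExtension i x) {d e : K} (he : e ≠ 0) : i e - i d * x ^ 2 ≠ 0 := by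
  intro h
  have := hx.eq_zero_of_eval₂ (.C e - .C d * .X ^ 2) (by simpa using h)
  exact he (by simpa using congrArg (Polynomial.coeff · 0) this)

theorem two_ne_zero_of_algebra {F : Type*} (L : Type*) [Field F] [Field L] [Algebra F L]
    (h : (2 : F) ≠ 0) : (2 : L) ≠ 0 := by
  rw [← map_ofNat (algebraMap F L)]
  exact (map_ne_zero (algebraMap F L)).2 h

/-- For `ds = ⟨d₁, …, dₖ⟩` and `e ≠ 0`, the value `s = e - ∑ dᵢ xᵢ²` with new variables `xᵢ`
satisfies `ds ⊥ ⟨s⟩ ≅ ⟨e⟩ ⊥ ds'`, and if `p ⊥ ds` is anisotropic and represents `-s`, then `p`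
represents `-e`. -/
theorem exists_generic_complement {F : Type u} [Field F] (h2 : (2 : F) ≠ 0) {m : ℕ}
    (ds : List (RatFun F m)) {e : RatFun F m} (he : e ≠ 0) :
    ∃ (n : ℕ) (J : TowerHom.{u} m n) (s : RatFun F n) (ds' : List (RatFun F n)), s ≠ 0 ∧
      DiagEquiv (ds.map (J.hom F) ++ [s]) (J.hom F e :: ds') ∧
      ∀ (L : Type u) [Field L] [Algebra F L] (p : List (RatFun L m)),
        ¬ DiagIso (p ++ ds.map (transMap F L m)) →
        DiagRep ((p ++ ds.map (transMap F L m)).map (J.hom L)) (-transMap F L n s) →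
        DiagRep p (-transMap F L m e) := by
  obtain ⟨k, hk⟩ : ∃ k, ds.length = k := ⟨_, rfl⟩
  induction k generalizing m with
  | zero =>
    obtain rfl := List.length_eq_zero_iff.1 hk
    refine ⟨m, .refl m, e, [], he, .of_perm (.refl _), fun L _ _ p _ h => ?_⟩
    simpa [TowerHom.refl] using h
  | succ k ih =>
    obtain ⟨d, ds, rfl⟩ := List.exists_cons_of_length_eq_add_one hk
    have hs (L : Type u) [Field L] := isRationalExtension_stepHom (L := L) (m := m)
    obtain ⟨n, J, s, ds', hs0, hequiv, hrep⟩ :=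
      ih (ds.map (stepHom F m)) ((hs F).sub_mul_sq_ne_zero (d := d) he)
        (by simpa using hk)
    refine ⟨n, J.precompStep, s, J.precompStep.hom F d *
      J.hom F (stepHom F m e - stepHom F m d * stepVar F m ^ 2) * J.precompStep.hom F e :: ds',
      hs0, ?_, fun L _ _ p hp h => ?_⟩
    · refine DiagEquiv.trans (DiagEquiv.append_left [J.precompStep.hom F d] (l' := _) ?_)
        (DiagEquiv.binary (x := J.hom F (stepVar F m)) (y := 1) ?_ ?_ ds')
      · simpa [TowerHom.precompStep] using hequiv
      · simp [TowerHom.precompStep]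
      · simpa using he
    · have hcomm (z : RatFun F m) := RingHom.congr_fun (transMap_comp_stepHom F L m) z
      have hmap : (p ++ (d :: ds).map (transMap F L m)).map (stepHom L m) =
          (p ++ [transMap F L m d]).map (stepHom L m) ++
            (ds.map (stepHom F m)).map (transMap F L (m + 1)) := by
        simpa using fun a _ => (hcomm a).symm
      have hval : -transMap F L (m + 1) (stepHom F m e - stepHom F m d * stepVar F m ^ 2) =
          stepHom L m (transMap F L m d) * stepVar L m ^ 2 +
            stepHom L m (-transMap F L m e) := by
        have hd := hcomm d
        have he := hcomm e
        simp only [RingHom.comp_apply] at hd he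
        rw [map_sub, map_mul, map_pow, transMap_stepVar, hd, he, map_neg]
        ring
      have hperm : (p ++ [transMap F L m d]).Perm (transMap F L m d :: p) :=
        List.perm_append_singleton _ _
      refine (hs L).diagRep_cancel (two_ne_zero_of_algebra _ (two_ne_zero_of_algebra L h2))
        (d := transMap F L m d) (fun hiso => hp ?_) ?_
      · rw [List.map_cons, List.append_cons, diagIso_append]
        exact Or.inl ((SameValues.of_perm hperm).1.2 hiso)
      · rw [← hval, ← (SameValues.of_perm (hperm.map _)).2]
        refine hrep L _ (fun hiso => hp ((hs L).diagIso_of_map ?_)) ?_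
        · rwa [hmap]
        · rw [← hmap, List.map_map]
          exact h

theorem exists_pfisterList_control {F : Type u} [Field F] (h2 : (2 : F) ≠ 0) (b : List F)
    (hb : ∀ c ∈ b, c ≠ 0) :
    ∃ (m : ℕ) (as ds : List (RatFun F m)), (∀ a ∈ as, a ≠ 0) ∧
      DiagEquiv (pfisterList as) (b.map (toFrac F m) ++ ds) ∧
      ∀ (L : Type u) [Field L] [Algebra F L],
        (∀ l : List L, DiagIso (l.map (toFrac L m)) → DiagIso l) ∧
        (DiagIso (pfisterList (as.map (transMap F L m))) → DiagIso (b.map (algebraMap F L))) := by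
  induction b with
  | nil =>
    refine ⟨0, [], [1], by simp, .of_perm (.refl _), fun L _ _ =>
      ⟨fun _ => diagIso_of_map_toFrac_zero, fun h => ?_⟩⟩
    simp [pfisterList, DiagIso, DiagRep] at h
  | cons c b ih =>
    obtain ⟨m, as, ds, has, hequiv, hL⟩ := ih fun a ha => hb a (List.mem_cons_of_mem c ha)
    have hc0 : toFrac F m c ≠ 0 := (map_ne_zero _).2 (hb c List.mem_cons_self)
    obtain ⟨n, J, s, ds', hs0, hds, hrep⟩ := exists_generic_complement h2 ds hc0
    have has' : ∀ a ∈ as.map (J.hom F), a ≠ 0 := by simpa using has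
    obtain ⟨rest, hrest⟩ := pfisterList_eq_cons (as.map (J.hom F))
    have hJ (L : Type u) [Field L] (l : List L) :
        (l.map (toFrac L m)).map (J.hom L) = l.map (toFrac L n) := by
      simp [J.hom_toFrac]
    refine ⟨n, -s :: as.map (J.hom F), ds' ++ rest.map (s * ·), ?_, ?_, fun L _ _ => ⟨fun l h => ?_,
      fun h => ?_⟩⟩
    · simpa [hs0] using has
    · have h1 : DiagEquiv (pfisterList (-s :: as.map (J.hom F)))
          ((b.map (toFrac F n) ++ ds.map (J.hom F)) ++ s :: rest.map (s * ·)) := by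
        have := (hequiv.map (J.hom F)).append_right ((pfisterList (as.map (J.hom F))).map (s * ·))
        rw [List.map_append, hJ, map_pfisterList] at this
        rw [pfisterList, neg_neg]
        convert this using 2
        simp [hrest]
      have h2 := (hds.append_left (b.map (toFrac F n))).append_right (rest.map (s * ·))
      rw [J.hom_toFrac] at h2
      refine h1.trans (.trans ?_ (h2.trans ?_))
      · exact .of_perm (by simp)
      · exact .of_perm (by simp)
    · rw [← hJ] at h
      exact (hL L).1 l (J.diagIso_of_map L h)
    · have hb' : (b.map (toFrac F m)).map (transMap F L m) =
          (b.map (algebraMap F L)).map (toFrac L m) := by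
        simpa using fun a _ => RingHom.congr_fun (transMap_comp_toFrac F L m) a
      have hasL : (as.map (J.hom F)).map (transMap F L n) =
          (as.map (transMap F L m)).map (J.hom L) := by
        simpa using fun a _ => J.transMap_hom F L a
      have hE := hequiv _ (transMap F L m)
      rw [map_pfisterList, List.map_append, hb'] at hE
      by_cases hiso : DiagIso (pfisterList (as.map (transMap F L m)))
      · exact Or.inl ((hL L).2 hiso)
      rw [List.map_cons, map_neg] at h
      obtain h | h := DiagIso.pfister_cons (by simpa using hs0) (by simpa using has) h
      · rw [hasL, ← map_pfisterList] at h
        exact absurd (J.diagIso_of_map L h) hiso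
      · have hE' := hequiv _ ((J.hom L).comp (transMap F L m))
        rw [hasL, ← map_pfisterList, ← map_pfisterList, List.map_map] at h
        replace h := (hE'.2 _).1 h
        have hmap : ((b.map (algebraMap F L)).map (toFrac L m) ++ ds.map (transMap F L m)).map
            (J.hom L) = (b.map (toFrac F m) ++ ds).map ((J.hom L).comp (transMap F L m)) := by
          rw [← hb', ← List.map_append, List.map_map]; rfl
        rw [← hmap] at h
        have hr := hrep L _ (fun hi => hiso (hE.1.2 hi)) h
        have hcL : transMap F L m (toFrac F m c) = toFrac L m (algebraMap F L c) :=
          RingHom.congr_fun (transMap_comp_toFrac F L m) c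
        rw [hcL] at hr
        refine (hL L).1 _ (Or.inr ⟨1, one_ne_zero, ?_⟩)
        simpa using hr

end Control

section Bridges

theorem QuadraticForm.mapAlong_eq {k E : Type*} [CommRing k] [CommRing E] (f : k →+* E) {n : ℕ}
    {q : QuadraticForm k (Fin n → k)} {Q : QuadraticForm E (Fin n → E)}
    (hq : ∀ i, Q (Pi.single i 1) = f (q (Pi.single i 1)))
    (hpolar : ∀ i j, QuadraticMap.polar Q (Pi.single i 1) (Pi.single j 1) =
      f (QuadraticMap.polar q (Pi.single i 1) (Pi.single j 1))) :
    q.mapAlong f = Q := by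
  rw [← Q.toQuadraticMap_toBilin (Pi.basisFun E (Fin n))]
  rw [QuadraticForm.mapAlong, Matrix.toQuadraticMap', Matrix.toQuadraticForm']
  congr 1
  refine (Pi.basisFun E (Fin n)).ext fun i => (Pi.basisFun E (Fin n)).ext fun j => ?_
  rw [QuadraticMap.toBilin_apply, Pi.basisFun_apply, Pi.basisFun_apply,
    Matrix.toLinearMap₂'_apply']
  simp [hq, hpolar]

theorem isIsotropic_weightedSumSquares_iff {K ι : Type*} [Field K] [Fintype ι] (w : ι → K)
    {l : List K} (h : (l : Multiset K) = Finset.univ.val.map w) :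
    (QuadraticMap.weightedSumSquares K w).IsIsotropic ↔ DiagIso l := by
  let e := Fintype.equivFin ι
  have hl : l.Perm (List.ofFn (w ∘ e.symm)) := by
    rw [← Multiset.coe_eq_coe, h, ← Fin.univ_val_map, ← Multiset.map_map]
    congr 1
    exact (congrArg Finset.val (Finset.map_univ_equiv e.symm)).symm
  rw [(SameValues.of_perm hl).1, diagIso_ofFn]
  refine ⟨fun ⟨v, hv, h0⟩ => ⟨v ∘ e.symm, fun h1 => hv ?_, ?_⟩,
    fun ⟨v, hv, h0⟩ => ⟨v ∘ e, fun h1 => hv ?_, ?_⟩⟩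
  · funext i
    simpa using congrFun h1 (e i)
  · rw [← h0, QuadraticMap.weightedSumSquares_apply, ← e.symm.sum_comp]
    simp [pow_two]
  · funext i
    simpa using congrFun h1 (e.symm i)
  · rw [← h0, QuadraticMap.weightedSumSquares_apply, ← e.symm.sum_comp]
    simp [pow_two]

theorem coe_pfisterList_map {K : Type u} {ι : Type*} [Field K] (a : ι → K) (l : List ι) :
    (pfisterList (l.map a) : Multiset K) =
      (l : Multiset ι).powerset.map fun s => (s.map fun i => -a i).prod := by
  induction l with
  | nil => simp [pfisterList]
  | cons i l ih =>
    rw [List.map_cons, pfisterList, ← Multiset.coe_add, ← Multiset.map_coe, ih,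
      ← Multiset.cons_coe, Multiset.powerset_cons, Multiset.map_add, Multiset.map_map,
      Multiset.map_map]
    simp

theorem isIsotropic_pfisterForm_iff {K : Type u} [Field K] {n : ℕ} (a : Fin n → K) :
    (PfisterForm a).IsIsotropic ↔ DiagIso (pfisterList (List.ofFn a)) := by
  refine isIsotropic_weightedSumSquares_iff _ ?_
  have h : (Finset.univ : Finset (Finset (Fin n))).val.map Finset.val =
      ((List.finRange n : List (Fin n)) : Multiset (Fin n)).powerset := by
    rw [← Finset.powerset_univ]
    simp only [Finset.powerset, Multiset.map_pmap, Multiset.pmap_eq_map, Multiset.map_id']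
    rfl
  rw [List.ofFn_eq_map, coe_pfisterList_map, ← h, Multiset.map_map]
  rfl

theorem LinearEquiv.exists_baseChange_pi {k E : Type*} [Field k] [Field E] (f : k →+* E)
    {r s : ℕ} (e : (Fin r → k) ≃ₗ[k] (Fin s → k)) :
    ∃ g : (Fin r → E) ≃ₗ[E] (Fin s → E), ∀ v, g (f ∘ v) = f ∘ e v := by
  let A := LinearMap.toMatrix' e.toLinearMap
  let B := LinearMap.toMatrix' e.symm.toLinearMap
  have hAB : A * B = 1 := by
    rw [← LinearMap.toMatrix'_comp, LinearEquiv.comp_symm, LinearMap.toMatrix'_id]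
  have hBA : B * A = 1 := by
    rw [← LinearMap.toMatrix'_comp, LinearEquiv.symm_comp, LinearMap.toMatrix'_id]
  have hAB' : A.map f * B.map f = 1 := by rw [← Matrix.map_mul, hAB]; simp
  have hBA' : B.map f * A.map f = 1 := by rw [← Matrix.map_mul, hBA]; simp
  refine ⟨Matrix.toLin'OfInv hBA' hAB', fun v => ?_⟩
  funext i
  have he : e v = A.mulVec v := (LinearMap.toMatrix'_mulVec e.toLinearMap v).symm
  rw [Function.comp_apply, he, RingHom.map_mulVec]
  rfl

theorem exists_diagonal_coefficients {F : Type u} [Field F] (hF : ringChar F ≠ 2) {r : ℕ}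
    (q : QuadraticForm F (Fin r → F)) (hq : (QuadraticMap.polarBilin q).Nondegenerate) :
    ∃ b : List F, (∀ c ∈ b, c ≠ 0) ∧ ∀ (L : Type u) [Field L] [Algebra F L],
      (q.mapAlong (algebraMap F L)).IsIsotropic ↔ DiagIso (b.map (algebraMap F L)) := by
  have h2 : (2 : F) ≠ 0 := Ring.two_ne_zero hF
  let _ : Invertible (2 : F) := invertibleOfNonzero h2
  have hassoc : (QuadraticMap.associated (R := F) q).SeparatingLeft := fun x hx =>
    hq.1 x fun y => by
      rw [← QuadraticMap.two_nsmul_associated F, LinearMap.smul_apply, LinearMap.smul_apply,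
        hx y, smul_zero]
  obtain ⟨w, ⟨e⟩⟩ := q.equivalent_weightedSumSquares_units_of_nondegenerate' hassoc
  refine ⟨List.ofFn fun i => (w i : F), by simp, fun L _ _ => ?_⟩
  let f := algebraMap F L
  obtain ⟨g, hg⟩ := LinearEquiv.exists_baseChange_pi f e.toLinearEquiv
  have hval (v : Fin r → F) : QuadraticMap.weightedSumSquares L (fun i => f (w i)) (g (f ∘ v)) =
      f (q v) := by
    rw [hg, ← e.map_app]
    change _ = f (QuadraticMap.weightedSumSquares F w (e.toLinearEquiv v))
    simp only [QuadraticMap.weightedSumSquares_apply, Units.smul_def, map_sum, map_mul,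
      smul_eq_mul, Function.comp_apply]
  have hsingle (i : Fin r) : (Pi.single i 1 : Fin r → L) = f ∘ Pi.single i 1 := by
    funext j
    simp [Pi.single_apply, apply_ite f]
  have hmap : q.mapAlong f = (QuadraticMap.weightedSumSquares L fun i => f (w i)).comp
      g.toLinearMap := by
    refine QuadraticForm.mapAlong_eq f (fun i => ?_) fun i j => ?_
    · rw [hsingle]; exact hval _
    · have hadd : f ∘ Pi.single i 1 + f ∘ Pi.single j 1 =
          f ∘ (Pi.single i 1 + Pi.single j 1 : Fin r → F) := by
        funext k; simp
      rw [hsingle, hsingle, QuadraticMap.polar, QuadraticMap.polar, hadd, map_sub, map_sub,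
        ← hval, ← hval, ← hval]
      rfl
  rw [← isIsotropic_weightedSumSquares_iff (fun i => f (w i))
    (by rw [Fin.univ_val_map, List.map_ofFn]; rfl), hmap]
  exact ⟨fun ⟨v, hv, h⟩ => ⟨g v, by simpa using hv, h⟩,
    fun ⟨v, hv, h⟩ => ⟨g.symm v, by simpa using hv, by simpa using h⟩⟩

end Bridges

/-- **Quadrics are controlled by Pfister forms over a purely transcendental extension.**
For a nondegenerate quadratic form `q` of rank `r ≥ 2` over `F` there are `m`, `n` and units
`a_1, …, a_n` of `F(x_1, …, x_m)` such that for every field extension `L/F`, `q` is isotropic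
over `L` iff the Pfister form `⟨⟨a_1, …, a_n⟩⟩` is isotropic over `L(x_1, …, x_m)`. -/
theorem quadric_controlled_by_pfister {F : Type u} [Field F] (hF : ringChar F ≠ 2)
    {r : ℕ} (hr : 2 ≤ r) (q : QuadraticForm F (Fin r → F))
    (hq : (QuadraticMap.polarBilin q).Nondegenerate) :
    ∃ (m n : ℕ) (a : Fin n → (FractionRing (MvPolynomial (Fin m) F))ˣ),
      ∀ (L : Type u) [Field L] [Algebra F L],
        (q.mapAlong (algebraMap F L)).IsIsotropic ↔
          (PfisterForm fun i => transMap F L m (a i)).IsIsotropic := by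
  have h2 : (2 : F) ≠ 0 := Ring.two_ne_zero hF
  obtain ⟨b, hb, hqb⟩ := exists_diagonal_coefficients hF q hq
  obtain ⟨m, as, ds, has, hequiv, hL⟩ := exists_pfisterList_control h2 b hb
  refine ⟨m, as.length, fun i => Units.mk0 (as.get i) (has _ (as.get_mem i)), fun L _ _ => ?_⟩
  have hlist : List.ofFn (fun i => transMap F L m (as.get i)) = as.map (transMap F L m) := by
    conv_rhs => rw [← List.ofFn_get as, List.map_ofFn]
    rfl
  simp only [Units.val_mk0]
  rw [hqb, isIsotropic_pfisterForm_iff, hlist]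
  refine ⟨fun h => ?_, (hL L).2⟩
  rw [← map_pfisterList, (hequiv _ (transMap F L m)).1, List.map_append, diagIso_append]
  left
  convert h.map (toFrac L m) using 1
  simpa using fun a _ => RingHom.congr_fun (transMap_comp_toFrac F L m) a
end
end

section
/- Specialization to subforms. Let k be a field of characteristic ≠ 2, let q be an anisotropic quadratic form on k^m, and let p be a nonzero quadratic form on k^n. Suppose that q, base-changed to K = k(X_1, …, X_n), represents the generic value p(X). Then for every nonzero subform p' of p, say defined on k^{n'} via an injective linear map into k^n, the form q, base-changed to K' = k(Y_1, …, Y_{n'}), represents the generic value p'(Y). -/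
noncomputable section

open scoped BigOperators

namespace QuadraticForm

/-- A quadratic form on `R^n` is determined by its values on the standard basis vectors and its
polar values on pairs of standard basis vectors. -/
theorem ext_single {R : Type*} [CommRing R] {n : ℕ} {Q₁ Q₂ : QuadraticForm R (Fin n → R)}
    (h : ∀ i, Q₁ (Pi.single i 1) = Q₂ (Pi.single i 1))
    (hpolar : ∀ i j, QuadraticMap.polar Q₁ (Pi.single i 1) (Pi.single j 1) =
      QuadraticMap.polar Q₂ (Pi.single i 1) (Pi.single j 1)) : Q₁ = Q₂ := by
  rw [← QuadraticMap.toQuadraticMap_toBilin Q₁ (Pi.basisFun R (Fin n)),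
    ← QuadraticMap.toQuadraticMap_toBilin Q₂ (Pi.basisFun R (Fin n))]
  simp only [QuadraticMap.toBilin, Pi.basisFun_apply, h, hpolar]

variable {k E E' : Type*} [CommRing k] [CommRing E] [CommRing E'] {n n' : ℕ}

theorem mapAlong_apply (f : k →+* E) (q : QuadraticForm k (Fin n → k)) (w : Fin n → E) :
    q.mapAlong f w = ∑ i, ∑ j, (if i = j then f (q (Pi.single i 1))
      else if i < j then f (QuadraticMap.polar q (Pi.single i 1) (Pi.single j 1)) else 0) *
        w i * w j := by
  simp only [mapAlong, Matrix.toQuadraticMap', Matrix.toQuadraticForm',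
    LinearMap.BilinMap.toQuadraticMap_apply, Matrix.toLinearMap₂'_apply, Matrix.of_apply,
    smul_eq_mul]
  exact Finset.sum_congr rfl fun i _ => Finset.sum_congr rfl fun j _ => by ring

theorem map_mapAlong (f : k →+* E) (g : E →+* E') (q : QuadraticForm k (Fin n → k))
    (w : Fin n → E) : g (q.mapAlong f w) = q.mapAlong (g.comp f) (fun i => g (w i)) := by
  simp only [mapAlong_apply, map_sum, map_mul, apply_ite g, map_zero, RingHom.comp_apply]

theorem mapAlong_id (q : QuadraticForm k (Fin n → k)) : q.mapAlong (RingHom.id k) = q := by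
  conv_rhs => rw [← QuadraticMap.toQuadraticMap_toBilin q (Pi.basisFun k (Fin n))]
  rw [mapAlong, Matrix.toQuadraticMap', Matrix.toQuadraticForm']
  congr 1
  refine LinearMap.ext_basis (Pi.basisFun k (Fin n)) (Pi.basisFun k (Fin n)) fun i j => ?_
  rw [QuadraticMap.toBilin_apply]
  rw [Pi.basisFun_apply, Pi.basisFun_apply, Matrix.toLinearMap₂'_apply,
    Finset.sum_eq_single i (by simp +contextual) (by simp),
    Finset.sum_eq_single j (by simp +contextual) (by simp)]
  simp

theorem mapAlong_map (f : k →+* E) (q : QuadraticForm k (Fin n → k)) (v : Fin n → k) :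
    q.mapAlong f (fun i => f (v i)) = f (q v) := by
  conv_rhs => rw [← mapAlong_id q, map_mapAlong, RingHom.comp_id]

theorem mapAlong_single (f : k →+* E) (q : QuadraticForm k (Fin n → k)) (i : Fin n) :
    q.mapAlong f (Pi.single i 1) = f (q (Pi.single i 1)) := by
  rw [← mapAlong_map]
  congr 1
  ext j
  simp [Pi.single_apply, apply_ite f]

theorem polar_mapAlong_map (f : k →+* E) (q : QuadraticForm k (Fin n → k)) (v w : Fin n → k) :
    QuadraticMap.polar (q.mapAlong f) (fun i => f (v i)) (fun i => f (w i)) =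
      f (QuadraticMap.polar q v w) := by
  simp only [QuadraticMap.polar, map_sub, ← mapAlong_map f q, Pi.add_apply, map_add]
  rfl

theorem polar_mapAlong_single (f : k →+* E) (q : QuadraticForm k (Fin n → k)) (i j : Fin n) :
    QuadraticMap.polar (q.mapAlong f) (Pi.single i 1) (Pi.single j 1) =
      f (QuadraticMap.polar q (Pi.single i 1) (Pi.single j 1)) := by
  rw [← polar_mapAlong_map]
  congr 1 <;> ext l <;> simp [Pi.single_apply, apply_ite f]

/-- Base change is compatible with pulling back along a linear map. -/
theorem mapAlong_linearMap (φ : k →+* E) (p : QuadraticForm k (Fin n → k))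
    (p' : QuadraticForm k (Fin n' → k)) (f : (Fin n' → k) →ₗ[k] (Fin n → k))
    (hf : ∀ v, p (f v) = p' v) (y : Fin n' → E) :
    p.mapAlong φ (fun i => ∑ j, φ (f (Pi.single j 1) i) * y j) = p'.mapAlong φ y := by
  let M : Matrix (Fin n) (Fin n') E := Matrix.of fun i j => φ (f (Pi.single j 1) i)
  have hM (j) : M.mulVecLin (Pi.single j 1) = fun i => φ (f (Pi.single j 1) i) := by
    ext i
    simp [M]
  suffices h : (p.mapAlong φ).comp M.mulVecLin = p'.mapAlong φ from
    DFunLike.congr_fun h y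
  refine ext_single (fun i => ?_) fun i j => ?_
  · rw [QuadraticMap.comp_apply, hM, mapAlong_map, hf, mapAlong_single]
  · rw [polar_mapAlong_single]
    have : QuadraticMap.polar ((p.mapAlong φ).comp M.mulVecLin) (Pi.single i 1) (Pi.single j 1) =
        QuadraticMap.polar (p.mapAlong φ) (M.mulVecLin (Pi.single i 1))
          (M.mulVecLin (Pi.single j 1)) := by
      simp only [QuadraticMap.polar, QuadraticMap.comp_apply, map_add]
    rw [this, hM, hM, polar_mapAlong_map]
    simp only [QuadraticMap.polar, ← map_add, hf]

open Polynomial in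
theorem coeff_zero_mapAlong (f : k →+* E) (q : QuadraticForm k (Fin n → k)) (v : Fin n → E[X]) :
    (q.mapAlong (C.comp f) v).coeff 0 = q.mapAlong f (fun i => (v i).coeff 0) := by
  have h := map_mapAlong (C.comp f) (evalRingHom 0) q v
  have hc : (evalRingHom (0 : E)).comp (C.comp f) = f := by ext; simp
  rw [hc] at h
  simpa only [coe_evalRingHom, ← coeff_zero_eq_eval_zero] using h

open Polynomial in
theorem exists_eq_X_smul {f : k →+* E} {q : QuadraticForm k (Fin n → k)}
    (hq : (q.mapAlong f).Anisotropic) {v : Fin n → E[X]}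
    (hv : (q.mapAlong (C.comp f) v).coeff 0 = 0) : ∃ v' : Fin n → E[X], v = (X : E[X]) • v' := by
  rw [coeff_zero_mapAlong] at hv
  have h (i) : X ∣ v i := X_dvd_iff.mpr (congr_fun (hq _ hv) i)
  choose v' hv' using h
  exact ⟨v', funext hv'⟩

open Polynomial in
theorem anisotropic_mapAlong_polynomial [IsDomain E] {f : k →+* E}
    {q : QuadraticForm k (Fin n → k)} (hq : (q.mapAlong f).Anisotropic) :
    (q.mapAlong ((C : E →+* E[X]).comp f)).Anisotropic := by
  have key (N : ℕ) : ∀ v : Fin n → E[X], q.mapAlong (C.comp f) v = 0 → ∀ i, X ^ N ∣ v i := by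
    induction N with
    | zero => simp
    | succ N ih =>
      intro v hv i
      obtain ⟨v', rfl⟩ := exists_eq_X_smul hq (by rw [hv, coeff_zero])
      rw [QuadraticMap.map_smul, smul_eq_mul] at hv
      have := (mul_eq_zero.mp hv).resolve_left (mul_ne_zero X_ne_zero X_ne_zero)
      rw [pow_succ']
      exact mul_dvd_mul_left _ (ih v' this i)
  intro v hv
  ext i d
  exact X_pow_dvd_iff.mp (key (d + 1) v hv i) d d.lt_succ_self

theorem anisotropic_mapAlong_mvPolynomial [IsDomain k] {q : QuadraticForm k (Fin n → k)}
    (hq : q.Anisotropic) (r : ℕ) :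
    (q.mapAlong (MvPolynomial.C : k →+* MvPolynomial (Fin r) k)).Anisotropic := by
  have transfer {A B : Type _} [CommRing A] [CommRing B] (e : A ≃+* B) (f : k →+* A)
      (h : (q.mapAlong ((e : A →+* B).comp f)).Anisotropic) : (q.mapAlong f).Anisotropic := by
    intro v hv
    have := map_mapAlong f (e : A →+* B) q v
    rw [hv, map_zero] at this
    have h0 := h _ this.symm
    ext i
    exact e.injective ((congr_fun h0 i).trans (map_zero e).symm)
  induction r with
  | zero =>
    refine transfer (MvPolynomial.isEmptyRingEquiv k (Fin 0)) _ ?_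
    have : ((MvPolynomial.isEmptyRingEquiv k (Fin 0) : MvPolynomial (Fin 0) k →+* k).comp
        MvPolynomial.C) = RingHom.id k :=
      RingHom.ext fun x => (MvPolynomial.isEmptyRingEquiv k (Fin 0)).apply_symm_apply x
    rwa [this, mapAlong_id]
  | succ r ih =>
    refine transfer (MvPolynomial.finSuccEquiv k r).toRingEquiv _ ?_
    have : (((MvPolynomial.finSuccEquiv k r).toRingEquiv :
        MvPolynomial (Fin (r + 1)) k →+* Polynomial (MvPolynomial (Fin r) k)).comp
        MvPolynomial.C) = Polynomial.C.comp MvPolynomial.C := by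
      ext x : 1
      simp [MvPolynomial.finSuccEquiv_apply]
    rw [this]
    exact anisotropic_mapAlong_polynomial ih

open Polynomial in
/-- A representation of `P` by `q` up to a square over `E[T]` specializes to `T = 0`. -/
theorem exists_specialization [IsDomain E] {f : k →+* E} {q : QuadraticForm k (Fin n → k)}
    (hq : (q.mapAlong f).Anisotropic) (P : E[X]) (d : ℕ) :
    ∀ (H : E[X]) (G : Fin n → E[X]), H.natDegree = d → H ≠ 0 →
      q.mapAlong (C.comp f) G = H ^ 2 * P →
      ∃ (h : E) (g : Fin n → E), h ≠ 0 ∧ q.mapAlong f g = h ^ 2 * P.coeff 0 := by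
  induction d with
  | zero =>
    intro H G hd hH hG
    refine ⟨H.coeff 0, fun i => (G i).coeff 0, fun h0 => hH ?_, ?_⟩
    · rw [eq_C_of_natDegree_eq_zero hd, h0, C_0]
    · rw [← coeff_zero_mapAlong, hG, mul_coeff_zero, pow_two, mul_coeff_zero, pow_two]
  | succ d ih =>
    intro H G hd hH hG
    by_cases h0 : H.coeff 0 = 0
    · obtain ⟨H', rfl⟩ := X_dvd_iff.mpr h0
      obtain ⟨G', rfl⟩ := exists_eq_X_smul hq (v := G) (by
        rw [hG, mul_coeff_zero, pow_two, mul_coeff_zero, h0, zero_mul, zero_mul])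
      have hH' : H' ≠ 0 := right_ne_zero_of_mul hH
      refine ih H' G' ?_ hH' ?_
      · rw [natDegree_X_mul hH'] at hd
        omega
      · rw [QuadraticMap.map_smul, smul_eq_mul] at hG
        refine mul_left_cancel₀ (mul_ne_zero (X_ne_zero (R := E)) X_ne_zero) ?_
        rw [hG]
        ring
    · refine ⟨H.coeff 0, fun i => (G i).coeff 0, h0, ?_⟩
      rw [← coeff_zero_mapAlong, hG, mul_coeff_zero, pow_two, mul_coeff_zero, pow_two]

end QuadraticForm

theorem genericValue_eq_algebraMap {k : Type*} [Field k] {n : ℕ}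
    (p : QuadraticForm k (Fin n → k)) :
    genericValue p = algebraMap (MvPolynomial (Fin n) k) (FractionRing (MvPolynomial (Fin n) k))
      (p.mapAlong MvPolynomial.C MvPolynomial.X) := by
  rw [QuadraticForm.map_mapAlong]
  rfl

/-- `q` represents the generic value of `p` over the rational function field if and only if it
does so over the polynomial ring up to a nonzero square. -/
theorem represents_genericValue_iff {k : Type*} [Field k] {m n : ℕ}
    (q : QuadraticForm k (Fin m → k)) (p : QuadraticForm k (Fin n → k)) :
    (∃ w, q.mapAlong (toFrac k n) w = genericValue p) ↔
      ∃ (h : MvPolynomial (Fin n) k) (g : Fin m → MvPolynomial (Fin n) k), h ≠ 0 ∧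
        q.mapAlong MvPolynomial.C g = h ^ 2 * p.mapAlong MvPolynomial.C MvPolynomial.X := by
  set ι := algebraMap (MvPolynomial (Fin n) k) (FractionRing (MvPolynomial (Fin n) k)) with hι
  have hinj : Function.Injective ι := IsFractionRing.injective _ _
  constructor
  · rintro ⟨w, hw⟩
    obtain ⟨⟨h, hh⟩, hint⟩ := IsLocalization.exist_integer_multiples_of_finite
      (nonZeroDivisors (MvPolynomial (Fin n) k)) w
    choose g hg using hint
    refine ⟨h, g, nonZeroDivisors.ne_zero hh, hinj ?_⟩
    have hgw : (fun i => ι (g i)) = ι h • w := by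
      ext i
      rw [Pi.smul_apply, hg, Algebra.smul_def, smul_eq_mul]
    rw [QuadraticForm.map_mapAlong, hgw, QuadraticMap.map_smul, map_mul, map_pow,
      ← genericValue_eq_algebraMap, ← hw, smul_eq_mul, pow_two]
    rfl
  · rintro ⟨h, g, hh, hg⟩
    have h0 : ι h ≠ 0 := (map_ne_zero_iff _ hinj).mpr hh
    refine ⟨(ι h)⁻¹ • fun i => ι (g i), ?_⟩
    have := congrArg ι hg
    rw [QuadraticForm.map_mapAlong, map_mul, map_pow, ← genericValue_eq_algebraMap] at this
    rw [QuadraticMap.map_smul, smul_eq_mul, toFrac, this]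
    field_simp

theorem MvPolynomial.exists_eval₂_C_ne_zero {k : Type*} [Field k] {σ τ : Type*} [Nonempty τ]
    {h : MvPolynomial σ k} (hh : h ≠ 0) :
    ∃ z : σ → MvPolynomial τ k, eval₂ C z h ≠ 0 := by
  by_contra! H
  refine hh (map_injective _ (C_injective τ k) (funext fun z => ?_))
  rw [eval_map, H, map_zero, map_zero]

/-- **Specialization to subforms.** If an anisotropic quadratic form `q` on `k^m` represents,
over `K = k(X_1, …, X_n)`, the generic value of a nonzero form `p` on `k^n`, then for every
nonzero subform `p'` of `p` on `k^{n'}`, `q` represents over `K' = k(Y_1, …, Y_{n'})` the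
generic value of `p'`. -/
theorem represents_generic_value_of_subform {k : Type*} [Field k] (hk : ringChar k ≠ 2)
    {m n n' : ℕ} (q : QuadraticForm k (Fin m → k)) (hq : q.Anisotropic)
    (p : QuadraticForm k (Fin n → k)) (hp : p ≠ 0)
    (p' : QuadraticForm k (Fin n' → k)) (hp' : p' ≠ 0) (hsub : p'.IsSubform p)
    (hrep : ∃ w : Fin m → FractionRing (MvPolynomial (Fin n) k),
      (q.mapAlong (toFrac k n)) w = genericValue p) :
    ∃ w' : Fin m → FractionRing (MvPolynomial (Fin n') k),
      (q.mapAlong (toFrac k n')) w' = genericValue p' := by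
  rw [represents_genericValue_iff] at hrep ⊢
  obtain ⟨h, g, hh, hg⟩ := hrep
  obtain ⟨f, -, hf⟩ := hsub
  have : Nonempty (Fin n') := by
    by_contra hempty
    rw [not_nonempty_iff] at hempty
    exact hp' (QuadraticMap.ext fun v => by rw [Subsingleton.elim v 0]; simp)
  obtain ⟨z, hz⟩ := MvPolynomial.exists_eval₂_C_ne_zero (τ := Fin n') hh
  let l : Fin n → MvPolynomial (Fin n') k := fun i =>
    ∑ j, MvPolynomial.C (f (Pi.single j 1) i) * MvPolynomial.X j
  let φ : MvPolynomial (Fin n) k →+* Polynomial (MvPolynomial (Fin n') k) :=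
    MvPolynomial.eval₂Hom (Polynomial.C.comp MvPolynomial.C) fun i =>
      Polynomial.C (l i) + Polynomial.X * Polynomial.C (z i - l i)
  have hφC : φ.comp MvPolynomial.C = Polynomial.C.comp MvPolynomial.C := by
    ext x : 1
    simp [φ]
  have hφh : φ h ≠ 0 := by
    have h1 : (Polynomial.evalRingHom 1).comp φ = MvPolynomial.eval₂Hom MvPolynomial.C z :=
      MvPolynomial.ringHom_ext (by simp [φ]) (by simp [φ])
    intro h0
    refine hz ?_
    have := RingHom.congr_fun h1 h
    rw [RingHom.comp_apply, h0, map_zero] at this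
    exact this.symm
  have hφg := congrArg φ hg
  rw [QuadraticForm.map_mapAlong, hφC, map_mul, map_pow, QuadraticForm.map_mapAlong, hφC] at hφg
  obtain ⟨h', g', hh', hg'⟩ := QuadraticForm.exists_specialization
    (QuadraticForm.anisotropic_mapAlong_mvPolynomial hq n') _ _ _ _ rfl hφh hφg
  refine ⟨h', g', hh', ?_⟩
  rw [hg', QuadraticForm.coeff_zero_mapAlong,
    ← QuadraticForm.mapAlong_linearMap MvPolynomial.C p p' f hf]
  congr 2
  ext1 i
  simp [φ, l]
end
end

section
/- Substitution corollary. Let k be a field of characteristic ≠ 2, let q be an anisotropic quadratic form on k^m, and let p be a nonzero quadratic form on k^n. Suppose that q, base-changed to K = k(X_1, …, X_n), represents the generic value p(X). Then for every vector v ∈ k^n with p(v) ≠ 0 there exists w ∈ k^m with q(w) = p(v); that is, q represents every nonzero value of p over k. -/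
noncomputable section

open scoped BigOperators

open MvPolynomial in
/-- The coefficient of a product at the sum of two lower bounds for the supports. -/
theorem MonomialOrder.coeff_add_mul_of_forall_lt {σ R : Type*} [CommSemiring R]
    (o : MonomialOrder σ) {a b : MvPolynomial σ R} {α β : σ →₀ ℕ}
    (ha : ∀ γ, o.toSyn γ < o.toSyn α → coeff γ a = 0)
    (hb : ∀ γ, o.toSyn γ < o.toSyn β → coeff γ b = 0) :
    coeff (α + β) (a * b) = coeff α a * coeff β b := by
  classical
  rw [coeff_mul, Finset.sum_eq_single (α, β)]
  · rintro ⟨γ, δ⟩ hmem hne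
    rw [Finset.HasAntidiagonal.mem_antidiagonal] at hmem
    rcases lt_trichotomy (o.toSyn γ) (o.toSyn α) with h | h | h
    · rw [ha γ h, zero_mul]
    · obtain rfl := o.toSyn.injective h
      exact absurd (congrArg (Prod.mk γ) (add_left_cancel hmem)) hne
    · have hδ : o.toSyn δ < o.toSyn β := by
        by_contra! hle
        have := add_lt_add_of_lt_of_le h hle
        rw [← map_add, ← map_add, hmem] at this
        exact this.false
      rw [hb δ hδ, mul_zero]
  · simp

open MvPolynomial in
/-- A product has no terms below the sum of two lower bounds for the supports. -/
theorem MonomialOrder.coeff_mul_eq_zero_of_forall_lt {σ R : Type*} [CommSemiring R]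
    (o : MonomialOrder σ) {a b : MvPolynomial σ R} {α β ε : σ →₀ ℕ}
    (ha : ∀ γ, o.toSyn γ < o.toSyn α → coeff γ a = 0)
    (hb : ∀ γ, o.toSyn γ < o.toSyn β → coeff γ b = 0)
    (hε : o.toSyn ε < o.toSyn (α + β)) :
    coeff ε (a * b) = 0 := by
  classical
  rw [coeff_mul]
  refine Finset.sum_eq_zero ?_
  rintro ⟨γ, δ⟩ hmem
  rw [Finset.HasAntidiagonal.mem_antidiagonal] at hmem
  by_cases h : o.toSyn γ < o.toSyn α
  · rw [ha γ h, zero_mul]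
  · have hδ : o.toSyn δ < o.toSyn β := by
      by_contra! hle
      have := add_le_add (not_lt.mp h) hle
      rw [← map_add, ← map_add, hmem] at this
      exact this.not_gt hε
    rw [hb δ hδ, mul_zero]

theorem QuadraticForm.mapAlong_apply_s7 {k E : Type*} [CommRing k] [CommRing E] (f : k →+* E)
    {n : ℕ} (q : QuadraticForm k (Fin n → k)) (w : Fin n → E) :
    q.mapAlong f w = ∑ i, ∑ j, f (if i = j then q (Pi.single i 1)
      else if i < j then QuadraticMap.polar ⇑q (Pi.single i 1) (Pi.single j 1) else 0) *
        (w i * w j) := by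
  refine (Matrix.toLinearMap₂'_apply (R := E) (N₂ := E) (S₁ := E) (S₂ := E) _ w w).trans
    (Finset.sum_congr rfl fun i _ => Finset.sum_congr rfl fun j _ => ?_)
  simp only [Matrix.of_apply, smul_eq_mul, apply_ite f, map_zero]
  ring

/-- A quadratic form is determined by its values and polar values on the standard basis. -/
theorem QuadraticForm.mapAlong_id_s7 {k : Type*} [CommRing k] {n : ℕ}
    (q : QuadraticForm k (Fin n → k)) : q.mapAlong (RingHom.id k) = q := by
  ext w
  conv_rhs => rw [← QuadraticMap.toQuadraticMap_toBilin q (Pi.basisFun k (Fin n))]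
  rw [QuadraticForm.mapAlong_apply_s7]
  rw [LinearMap.BilinMap.toQuadraticMap_apply,
    ← LinearMap.sum_repr_mul_repr_mul (Pi.basisFun k (Fin n)) (Pi.basisFun k (Fin n)),
    Finsupp.sum_fintype _ _ (by simp)]
  refine Finset.sum_congr rfl fun i _ => ?_
  rw [Finsupp.sum_fintype _ _ (by simp)]
  refine Finset.sum_congr rfl fun j _ => ?_
  rw [QuadraticMap.toBilin_apply]
  simp only [Pi.basisFun_apply, Pi.basisFun_repr, RingHom.id_apply, smul_eq_mul]
  ring

theorem QuadraticForm.map_mapAlong_s7 {k E E' : Type*} [CommRing k] [CommRing E] [CommRing E']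
    (f : k →+* E) (g : E →+* E') {n : ℕ} (q : QuadraticForm k (Fin n → k)) (w : Fin n → E) :
    g (q.mapAlong f w) = q.mapAlong (g.comp f) fun i => g (w i) := by
  simp only [QuadraticForm.mapAlong_apply_s7, map_sum, map_mul, RingHom.comp_apply]

open MvPolynomial in
/-- If an anisotropic form represents `F ^ 2 * P` over a polynomial ring, where `F ≠ 0`, then it
represents the constant term of `P` over the base field. -/
theorem QuadraticForm.exists_eq_constantCoeff {k σ : Type*} [Field k] (o : MonomialOrder σ)
    {m : ℕ} (q : QuadraticForm k (Fin m → k)) (hq : q.Anisotropic)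
    (G : Fin m → MvPolynomial σ k) (F P : MvPolynomial σ k) (hF : F ≠ 0)
    (h : q.mapAlong C G = F * F * P) :
    ∃ w : Fin m → k, q w = coeff 0 P := by
  have hlow : ∀ β, (∀ i γ, o.toSyn γ < o.toSyn β → coeff γ (G i) = 0) →
      coeff (β + β) (q.mapAlong C G) = q fun i => coeff β (G i) := by
    intro β hβ
    conv_rhs => rw [← QuadraticForm.mapAlong_id_s7 q]
    simp only [QuadraticForm.mapAlong_apply_s7, coeff_sum, coeff_C_mul, RingHom.id_apply]
    refine Finset.sum_congr rfl fun i _ => Finset.sum_congr rfl fun j _ => ?_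
    rw [o.coeff_add_mul_of_forall_lt (hβ i) (hβ j)]
  have wf : WellFounded fun γ δ : σ →₀ ℕ => o.toSyn γ < o.toSyn δ :=
    InvImage.wf o.toSyn wellFounded_lt
  obtain ⟨α, hα, hαmin⟩ := wf.has_min {γ | coeff γ F ≠ 0} (ne_zero_iff.mp hF)
  have hFα : ∀ γ, o.toSyn γ < o.toSyn α → coeff γ F = 0 := fun γ hγ => by
    by_contra hne
    exact hαmin γ hne hγ
  have hFF : ∀ γ, o.toSyn γ < o.toSyn (α + α) → coeff γ (F * F) = 0 := fun γ hγ =>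
    o.coeff_mul_eq_zero_of_forall_lt hFα hFα hγ
  have hP : ∀ γ, o.toSyn γ < o.toSyn 0 → coeff γ P = 0 := fun γ hγ => by
    rw [map_zero] at hγ
    exact absurd hγ (not_lt.mpr (o.zero_le _))
  have hGα : ∀ i γ, o.toSyn γ < o.toSyn α → coeff γ (G i) = 0 := by
    by_contra! hne
    obtain ⟨i, γ, hγ, hi⟩ := hne
    obtain ⟨β, ⟨⟨j, hj⟩, hβα⟩, hβmin⟩ := wf.has_min
      {γ | (∃ i, coeff γ (G i) ≠ 0) ∧ o.toSyn γ < o.toSyn α} ⟨γ, ⟨i, hi⟩, hγ⟩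
    have hβ : ∀ i γ, o.toSyn γ < o.toSyn β → coeff γ (G i) = 0 := fun i γ hγ => by
      by_contra hne
      exact hβmin γ ⟨⟨i, hne⟩, hγ.trans hβα⟩ hγ
    have hzero := hlow β hβ
    rw [h, o.coeff_mul_eq_zero_of_forall_lt hFF hP
      (by simpa using add_lt_add hβα hβα)] at hzero
    exact hj (congrFun (hq _ hzero.symm) j)
  have hval := hlow α hGα
  rw [h, ← add_zero (α + α), o.coeff_add_mul_of_forall_lt hFF hP,
    o.coeff_add_mul_of_forall_lt hFα hFα] at hval
  refine ⟨(coeff α F)⁻¹ • fun i => coeff α (G i), ?_⟩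
  rw [QuadraticMap.map_smul, ← hval, smul_eq_mul]
  have : coeff α F ≠ 0 := hα
  field_simp

open MvPolynomial in
theorem MvPolynomial.bind₁_X_add_C_injective {σ R : Type*} [CommRing R] (v : σ → R) :
    Function.Injective (bind₁ fun i => X i + C (v i) : MvPolynomial σ R → MvPolynomial σ R) := by
  refine Function.LeftInverse.injective (g := bind₁ fun i => X i - C (v i)) fun f => ?_
  rw [bind₁_bind₁]
  simp

/-- **Substitution corollary.** If an anisotropic quadratic form `q` on `k^m` represents,
over `K = k(X_1, …, X_n)`, the generic value of a nonzero form `p` on `k^n`, then `q`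
represents over `k` every nonzero value of `p`. -/
theorem represents_values_of_generic_value {k : Type*} [Field k] (hk : ringChar k ≠ 2)
    {m n : ℕ} (q : QuadraticForm k (Fin m → k)) (hq : q.Anisotropic)
    (p : QuadraticForm k (Fin n → k)) (hp : p ≠ 0)
    (hrep : ∃ w : Fin m → FractionRing (MvPolynomial (Fin n) k),
      (q.mapAlong (toFrac k n)) w = genericValue p) :
    ∀ v : Fin n → k, p v ≠ 0 → ∃ w : Fin m → k, q w = p v := by
  obtain ⟨w, hw⟩ := hrep
  intro v _
  let A := MvPolynomial (Fin n) k
  let K := FractionRing A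
  obtain ⟨f, hf⟩ := IsLocalization.exist_integer_multiples_of_finite (nonZeroDivisors A) w
  choose g hg using hf
  have hpoly : q.mapAlong MvPolynomial.C g =
      (f : A) * f * p.mapAlong MvPolynomial.C MvPolynomial.X := by
    apply IsFractionRing.injective A K
    have hgw : (fun i => algebraMap A K (g i)) = algebraMap A K f • w := by
      funext i
      rw [hg i, Algebra.smul_def, Pi.smul_apply, smul_eq_mul]
    rw [map_mul, map_mul, QuadraticForm.map_mapAlong_s7, QuadraticForm.map_mapAlong_s7, hgw,
      QuadraticMap.map_smul, smul_eq_mul]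
    exact congrArg _ hw
  let φ : A →+* A :=
    (MvPolynomial.bind₁ fun i => MvPolynomial.X i + MvPolynomial.C (v i)).toRingHom
  have hφ : φ.comp MvPolynomial.C = MvPolynomial.C := by
    ext1 a
    exact MvPolynomial.bind₁_C_right _ a
  have hshift := congrArg φ hpoly
  rw [map_mul, map_mul, QuadraticForm.map_mapAlong_s7, hφ] at hshift
  obtain ⟨u, hu⟩ := QuadraticForm.exists_eq_constantCoeff MonomialOrder.lex q hq _ _ _
    ((map_ne_zero_iff φ (MvPolynomial.bind₁_X_add_C_injective v)).mpr
      (nonZeroDivisors.ne_zero f.2)) hshift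
  refine ⟨u, hu.trans ?_⟩
  rw [← MvPolynomial.constantCoeff_eq, QuadraticForm.map_mapAlong_s7, hφ,
    QuadraticForm.map_mapAlong_s7]
  have hid : (MvPolynomial.constantCoeff (σ := Fin n)).comp MvPolynomial.C = RingHom.id k := by
    ext a
    simp
  rw [hid, QuadraticForm.mapAlong_id_s7]
  refine congrArg p (funext fun i => ?_)
  have hX : φ (MvPolynomial.X i) = MvPolynomial.X i + MvPolynomial.C (v i) :=
    MvPolynomial.bind₁_X_right _ i
  simp [hX]
end
end

section
/- Subform–cancellation lemma. Let L be a field of characteristic ≠ 2 and let π be an anisotropic quadratic form on L^d that decomposes as an orthogonal sum π ≅ u ⊥ s, where u is a quadratic form on L^{d₁}, s is a quadratic form on L^{d₂}, and d₁ + d₂ = d (i.e. there is a linear isomorphism L^{d₁} × L^{d₂} ≅ L^d identifying π with the form (v, w) ↦ u(v) + s(w)). Let a ∈ L be a unit. Then the form s ⊥ ⟨a⟩ on L^{d₂+1}, given by (w, t) ↦ s(w) + a·t², is a subform of π if and only if the form u ⊥ ⟨−a⟩ on L^{d₁+1}, given by (v, t) ↦ u(v) − a·t², is isotropic. -/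
noncomputable section

open scoped BigOperators

/-- The reflection along a vector `v` with `q v ≠ 0` is an isometry. -/
theorem QuadraticForm.exists_reflection {K V : Type*} [Field K] [AddCommGroup V] [Module K V]
    (q : QuadraticForm K V) {v : V} (hv : q v ≠ 0) :
    ∃ τ : V →ₗ[K] V, (∀ z, q (τ z) = q z) ∧
      ∀ z, τ z = z - (QuadraticMap.polar q z v / q v) • v := by
  refine ⟨LinearMap.id - ((q v)⁻¹ • q.polarBilin.flip v).smulRight v, fun z => ?_, fun z => ?_⟩
  · have h : ∀ c : K, q (z + c • v) = q z + c * c * q v + c * QuadraticMap.polar q z v := by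
      intro c
      rw [QuadraticMap.map_add q, QuadraticMap.map_smul, QuadraticMap.polar_smul_right]
      simp only [smul_eq_mul]
    have h' := h (-(QuadraticMap.polar q z v / q v))
    rw [neg_smul, ← sub_eq_add_neg] at h'
    have hz : (LinearMap.id - ((q v)⁻¹ • q.polarBilin.flip v).smulRight v : V →ₗ[K] V) z
        = z - (QuadraticMap.polar q z v / q v) • v := by
      simp [div_eq_inv_mul]
    rw [hz, h']
    field_simp
    ring
  · simp [div_eq_inv_mul]

/-- An isometry preserves the polar form. -/
theorem QuadraticMap.polar_map_of_isometry {K V W : Type*} [CommRing K] [AddCommGroup V]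
    [Module K V] [AddCommGroup W] [Module K W] {p : QuadraticForm K V} {q : QuadraticForm K W}
    {σ : V →ₗ[K] W} (hσ : ∀ z, q (σ z) = p z) (x y : V) :
    QuadraticMap.polar q (σ x) (σ y) = QuadraticMap.polar p x y := by
  simp only [QuadraticMap.polar, ← map_add, hσ]

/-- **Witt extension** for anisotropic forms: two families of vectors with the same Gram data
are related by an isometry of the ambient space. -/
theorem QuadraticMap.Anisotropic.exists_isometry_map_eq {K V ι : Type*} [Field K]
    [AddCommGroup V] [Module K V] {q : QuadraticForm K V} (hq : q.Anisotropic) (x y : ι → V)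
    (hxy : ∀ i, q (x i) = q (y i))
    (hpolar : ∀ i j, QuadraticMap.polar q (x i) (x j) = QuadraticMap.polar q (y i) (y j))
    (s : Finset ι) :
    ∃ σ : V →ₗ[K] V, (∀ z, q (σ z) = q z) ∧ ∀ i ∈ s, σ (x i) = y i := by
  classical
  induction s using Finset.induction_on with
  | empty => exact ⟨LinearMap.id, fun _ => rfl, by simp⟩
  | insert n s _ ih =>
    obtain ⟨σ, hσ, hs⟩ := ih
    by_cases hn : σ (x n) = y n
    · refine ⟨σ, hσ, fun i hi => ?_⟩
      rcases Finset.mem_insert.mp hi with rfl | hi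
      exacts [hn, hs i hi]
    have hv : q (σ (x n) - y n) ≠ 0 := fun h => hn (sub_eq_zero.mp (hq _ h))
    obtain ⟨τ, hτ, hτ_apply⟩ := QuadraticForm.exists_reflection q hv
    refine ⟨τ ∘ₗ σ, fun z => by simp [hτ, hσ], fun i hi => ?_⟩
    rw [LinearMap.comp_apply, hτ_apply]
    rcases Finset.mem_insert.mp hi with rfl | hi
    · have h : QuadraticMap.polar q (σ (x i)) (σ (x i) - y i) = q (σ (x i) - y i) := by
        have h' := QuadraticMap.map_add q (σ (x i)) (-y i)
        rw [← sub_eq_add_neg, QuadraticMap.map_neg, QuadraticMap.polar_neg_right, ← hxy,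
          ← hσ (x i)] at h'
        rw [QuadraticMap.polar_sub_right, QuadraticMap.polar_self, h', nsmul_eq_mul]
        push_cast
        ring
      rw [h, div_self hv, one_smul, sub_sub_cancel]
    · have h : QuadraticMap.polar q (σ (x i)) (σ (x n) - y n) = 0 := by
        rw [QuadraticMap.polar_sub_right, QuadraticMap.polar_map_of_isometry hσ, hpolar, hs i hi,
          sub_self]
      rw [h, zero_div, zero_smul, sub_zero, hs i hi]

/-- **Subform–cancellation lemma.** If an anisotropic quadratic form `π` on `L^d` decomposes
as an orthogonal sum `π ≅ u ⊥ s` and `a` is a unit of `L`, then `s ⊥ ⟨a⟩` is a subform of `π`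
iff `u ⊥ ⟨-a⟩` is isotropic. -/
theorem subform_iff_isotropic {L : Type*} [Field L] (hL : ringChar L ≠ 2)
    {d d₁ d₂ : ℕ} (hd : d₁ + d₂ = d)
    (π : QuadraticForm L (Fin d → L)) (hπ : π.Anisotropic)
    (u : QuadraticForm L (Fin d₁ → L)) (s : QuadraticForm L (Fin d₂ → L))
    (e : ((Fin d₁ → L) × (Fin d₂ → L)) ≃ₗ[L] (Fin d → L))
    (he : ∀ v w, π (e (v, w)) = u v + s w)
    (a : L) (ha : a ≠ 0) :
    (s.prod (a • QuadraticMap.sq)).IsSubform π ↔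
      (u.prod ((-a) • QuadraticMap.sq)).IsIsotropic := by
  constructor
  · rintro ⟨f, -, hf⟩
    have hπf := QuadraticMap.polar_map_of_isometry hf
    have he' : ∀ z, π (e.toLinearMap z) = u.prod s z := fun z => he z.1 z.2
    have hπe := QuadraticMap.polar_map_of_isometry he'
    obtain ⟨σ, hσ, hσ_eq⟩ := hπ.exists_isometry_map_eq
      (fun i : Fin d₂ => f (Pi.single i 1, 0)) (fun i => e.toLinearMap (0, Pi.single i 1))
      (fun i => by simp only [hf, he']; simp)
      (fun i j => by simp only [hπf, hπe]; simp [QuadraticMap.polar]) Finset.univ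
    have hσf : σ ∘ₗ f ∘ₗ LinearMap.inl L _ _ = e.toLinearMap ∘ₗ LinearMap.inr L _ _ := by
      refine LinearMap.pi_ext' fun i => LinearMap.ext_ring ?_
      simpa using hσ_eq i (Finset.mem_univ i)
    obtain ⟨⟨v, w⟩, hvw⟩ := e.surjective (σ (f (0, 1)))
    have hw : QuadraticMap.polar s w w = 0 := by
      have h₁ : QuadraticMap.polar π (σ (f (0, 1))) (σ (f (w, 0))) = 0 := by
        rw [QuadraticMap.polar_map_of_isometry hσ, hπf]
        simp [QuadraticMap.polar]
      have h₂ : σ (f (w, 0)) = e.toLinearMap (0, w) := LinearMap.congr_fun hσf w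
      rw [h₂, ← hvw, ← LinearEquiv.coe_coe, hπe] at h₁
      simpa [QuadraticMap.polar] using h₁
    have hsw : s w = 0 := by
      rw [QuadraticMap.polar_self, nsmul_eq_mul] at hw
      exact (mul_eq_zero.mp hw).resolve_left (by exact_mod_cast Ring.two_ne_zero hL)
    have hv : u v = a := by
      have h := he v w
      rw [hvw, hσ, hf, hsw] at h
      simpa using h.symm
    refine ⟨(v, 1), by simp, by simp [hv]⟩
  · rintro ⟨⟨v, t⟩, hne, hvt⟩
    have huv : u v = a * (t * t) := by
      simpa [add_neg_eq_zero] using hvt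
    have ht : t ≠ 0 := by
      rintro rfl
      have h := hπ (e (v, 0)) (by simp [he, huv])
      simp only [map_eq_zero_iff e e.injective, Prod.mk_eq_zero] at h
      exact hne (by simp [h.1])
    have hu : u (t⁻¹ • v) = a := by
      rw [QuadraticMap.map_smul, huv, smul_eq_mul]
      field_simp
    have hv : t⁻¹ • v ≠ 0 := by
      intro h
      rw [h, QuadraticMap.map_zero] at hu
      exact ha hu.symm
    refine ⟨e.toLinearMap ∘ₗ
      ((LinearMap.snd L _ L).smulRight (t⁻¹ • v)).prod (LinearMap.fst L _ L), ?_, ?_⟩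
    · refine (injective_iff_map_eq_zero _).mpr ?_
      rintro ⟨w, r⟩ h
      have h' : e (r • t⁻¹ • v, w) = 0 := h
      rw [map_eq_zero_iff e e.injective, Prod.mk_eq_zero, smul_eq_zero_iff_left hv] at h'
      simp [h'.1, h'.2]
    · rintro ⟨w, r⟩
      change π (e (r • t⁻¹ • v, w)) = _
      rw [he, QuadraticMap.map_smul, hu]
      simp
      ring
end
end

section
/- Pfister-neighbour step. Let F be a field of characteristic ≠ 2, let a_1, …, a_n, c ∈ F be units, and let π = ⟨⟨a_1, …, a_n⟩⟩ be the n-fold Pfister form. Then the form π ⊥ ⟨−c⟩ of rank 2^n + 1, given by (v, t) ↦ π(v) − c·t², is isotropic over F if and only if the (n+1)-fold Pfister form ⟨⟨a_1, …, a_n, c⟩⟩ is isotropic over F. -/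
noncomputable section

open scoped BigOperators

namespace QuadraticMap

/-- A quadratic form is *round* if each of its values is the multiplier of a
self-similarity of the form. -/
def IsRound {F M : Type*} [Field F] [AddCommGroup M] [Module F M]
    (q : QuadraticForm F M) : Prop :=
  ∀ v, ∃ f : M →ₗ[F] M, ∀ w, q (f w) = q v * q w

/-- The orthogonal sum of a form with a scalar multiple of itself inherits roundness. -/
theorem IsRound.prod_smul {F M : Type*} [Field F] [AddCommGroup M] [Module F M]
    {q : QuadraticForm F M} (hq : q.IsRound) (b : F) : (q.prod (b • q)).IsRound := by
  rintro ⟨v₁, v₂⟩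
  obtain ⟨f₁, hf₁⟩ := hq v₁
  obtain ⟨f₂, hf₂⟩ := hq v₂
  simp only [Prod.forall, prod_apply, smul_apply, smul_eq_mul]
  by_cases h₁ : q v₁ = 0
  · refine ⟨(b • f₂.comp (.snd F M M)).prod (f₂.comp (.fst F M M)), fun w₁ w₂ => ?_⟩
    simp [hf₂, h₁, QuadraticMap.map_smul]
    ring
  by_cases h₂ : q v₂ = 0
  · refine ⟨f₁.prodMap f₁, fun w₁ w₂ => ?_⟩
    simp [hf₁, h₂]
    ring
  let k : M →ₗ[F] M := f₁.comp f₂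
  refine ⟨(f₁.comp (.fst F M M - (b * (q v₁)⁻¹) • k.comp (.snd F M M))).prod
    (f₂.comp (.fst F M M + (q v₂)⁻¹ • k.comp (.snd F M M))), fun w₁ w₂ => ?_⟩
  have hk : q (k w₂) = q v₁ * (q v₂ * q w₂) := by simp [k, hf₁, hf₂]
  have e₁ : q (w₁ - (b * (q v₁)⁻¹) • k w₂) = q w₁ + (b * (q v₁)⁻¹) ^ 2 * q (k w₂)
      - (b * (q v₁)⁻¹) * polar q w₁ (k w₂) := by
    rw [sub_eq_add_neg, ← neg_smul, QuadraticMap.map_add q, QuadraticMap.map_smul, polar_smul_right]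
    simp only [smul_eq_mul]
    ring
  have e₂ : q (w₁ + (q v₂)⁻¹ • k w₂) = q w₁ + ((q v₂)⁻¹) ^ 2 * q (k w₂)
      + (q v₂)⁻¹ * polar q w₁ (k w₂) := by
    rw [QuadraticMap.map_add q, QuadraticMap.map_smul, polar_smul_right]
    simp only [smul_eq_mul]
    ring
  change q (f₁ (w₁ - (b * (q v₁)⁻¹) • k w₂)) + b * q (f₂ (w₁ + (q v₂)⁻¹ • k w₂)) = _
  rw [hf₁, hf₂, e₁, e₂, hk]
  field_simp
  ring

theorem IsRound.of_isometryEquiv {F M N : Type*} [Field F] [AddCommGroup M] [Module F M]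
    [AddCommGroup N] [Module F N] {p : QuadraticForm F M} {q : QuadraticForm F N}
    (hp : p.IsRound) (e : p.IsometryEquiv q) : q.IsRound := by
  intro v
  obtain ⟨f, hf⟩ := hp (e.symm v)
  refine ⟨e.toLinearEquiv.toLinearMap ∘ₗ f ∘ₗ e.symm.toLinearEquiv.toLinearMap, fun w => ?_⟩
  have h := e.map_app (f (e.symm w))
  rw [hf, e.symm.map_app, e.symm.map_app] at h
  exact h

theorem IsIsotropic.of_isometryEquiv {R M N : Type*} [CommSemiring R] [AddCommMonoid M]
    [Module R M] [AddCommMonoid N] [Module R N] {p : QuadraticForm R M} {q : QuadraticForm R N}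
    (hp : p.IsIsotropic) (e : p.IsometryEquiv q) : q.IsIsotropic := by
  obtain ⟨v, hv, h⟩ := hp
  exact ⟨e v, fun h0 => hv (e.toLinearEquiv.map_eq_zero_iff.mp h0), (e.map_app v).trans h⟩

end QuadraticMap

/-- Subsets of `Fin (n + 1)` are subsets of `Fin n`, with or without the last element. -/
def finsetFinSuccEquiv (n : ℕ) : Finset (Fin n) ⊕ Finset (Fin n) ≃ Finset (Fin (n + 1)) :=
  Equiv.ofBijective
    (Sum.elim (fun S => S.map Fin.castSuccEmb)
      (fun S => insert (Fin.last n) (S.map Fin.castSuccEmb))) <| by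
    have hl (S : Finset (Fin n)) : Fin.last n ∉ S.map Fin.castSuccEmb := by
      simp [Fin.castSucc_ne_last]
    rw [Fintype.bijective_iff_injective_and_card]
    constructor
    · rintro (S | S) (T | T) h <;> simp only [Sum.elim_inl, Sum.elim_inr] at h
      · rw [Finset.map_injective _ h]
      · exact absurd (h ▸ Finset.mem_insert_self _ _) (hl S)
      · exact absurd (h ▸ Finset.mem_insert_self _ _) (hl T)
      · have h' := congrArg (Finset.erase · (Fin.last n)) h
        simp only [Finset.erase_insert (hl _)] at h'
        rw [Finset.map_injective _ h']
    · simp [pow_succ, mul_two]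

/-- `⟨⟨a_1, …, a_n, c⟩⟩` is the orthogonal sum of `⟨⟨a_1, …, a_n⟩⟩` and `-c⟨⟨a_1, …, a_n⟩⟩`. -/
def PfisterForm.snocIsometryEquiv {F : Type*} [Field F] {n : ℕ} (a : Fin n → F) (c : F) :
    (PfisterForm (Fin.snoc a c : Fin (n + 1) → F)).IsometryEquiv
      ((PfisterForm a).prod ((-c) • PfisterForm a)) where
  toLinearEquiv := (LinearEquiv.funCongrLeft F F (finsetFinSuccEquiv n)).trans
    (LinearEquiv.sumArrowLequivProdArrow _ _ F F)
  map_app' v := by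
    have hl (S : Finset (Fin n)) : Fin.last n ∉ S.map Fin.castSuccEmb := by
      simp [Fin.castSucc_ne_last]
    simp only [PfisterForm, QuadraticMap.weightedSumSquares_apply, QuadraticMap.prod_apply,
      smul_apply, ← (finsetFinSuccEquiv n).sum_comp (M := F), Fintype.sum_sum_type]
    simp [finsetFinSuccEquiv, Finset.prod_insert (hl _), Finset.mul_sum, mul_assoc]

theorem PfisterForm.isRound {F : Type*} [Field F] {n : ℕ} (a : Fin n → F) :
    (PfisterForm a).IsRound := by
  induction n with
  | zero =>
    intro v
    refine ⟨v ∅ • LinearMap.id, fun w => ?_⟩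
    simp [PfisterForm, Subsingleton.elim (default : Finset (Fin 0)) ∅]
    ring
  | succ n ih =>
    rw [← Fin.snoc_init_self a]
    exact ((ih _).prod_smul _).of_isometryEquiv (snocIsometryEquiv _ _).symm

theorem PfisterForm.apply_single_empty {F : Type*} [Field F] {n : ℕ} (a : Fin n → F) (t : F) :
    PfisterForm a (Pi.single ∅ t) = t * t := by
  rw [PfisterForm, QuadraticMap.weightedSumSquares_apply, Finset.sum_eq_single ∅] <;>
    simp +contextual

/-- **Pfister-neighbour step.** For units `a_1, …, a_n, c` of a field `F` of characteristic
`≠ 2`, the form `⟨⟨a_1, …, a_n⟩⟩ ⊥ ⟨-c⟩` of rank `2^n + 1` is isotropic over `F` iff the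
`(n+1)`-fold Pfister form `⟨⟨a_1, …, a_n, c⟩⟩` is isotropic over `F`. -/
theorem pfister_neighbour_step {F : Type*} [Field F] (hF : ringChar F ≠ 2) {n : ℕ}
    (a : Fin n → F) (ha : ∀ i, a i ≠ 0) (c : F) (hc : c ≠ 0) :
    ((PfisterForm a).prod ((-c) • QuadraticMap.sq)).IsIsotropic ↔
      (PfisterForm (Fin.snoc a c)).IsIsotropic := by
  have key : ((PfisterForm a).prod ((-c) • QuadraticMap.sq)).IsIsotropic ↔
      ((PfisterForm a).prod ((-c) • PfisterForm a)).IsIsotropic := by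
    constructor
    · rintro ⟨⟨v, t⟩, hne, h⟩
      refine ⟨(v, Pi.single ∅ t), fun h0 => hne ?_, ?_⟩
      · simpa using h0
      · simpa [PfisterForm.apply_single_empty] using h
    · rintro ⟨⟨v, w⟩, hne, h⟩
      simp only [QuadraticMap.prod_apply, smul_apply, smul_eq_mul] at h
      by_cases hw : PfisterForm a w = 0
      · have hv : PfisterForm a v = 0 := by simpa [hw] using h
        by_cases hv0 : v = 0
        · exact ⟨(w, 0), fun h0 => hne (by simp_all), by simp [hw]⟩
        · exact ⟨(v, 0), fun h0 => hv0 (congrArg Prod.fst h0), by simp [hv]⟩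
      · obtain ⟨f, hf⟩ := PfisterForm.isRound a w
        refine ⟨(f v, PfisterForm a w), fun h0 => hw (congrArg Prod.snd h0), ?_⟩
        simp only [QuadraticMap.prod_apply, smul_apply, smul_eq_mul, hf,
          QuadraticMap.sq_apply]
        linear_combination PfisterForm a w * h
  exact key.trans ⟨fun h => h.of_isometryEquiv (PfisterForm.snocIsometryEquiv a c).symm,
    fun h => h.of_isometryEquiv (PfisterForm.snocIsometryEquiv a c)⟩
end
end
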